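/- arXiv:2006.07439 — 2 statements merged into one kernel-verified Lean document; each statement's English description precedes it below -/
import Mathlib

section
/- There exist constants C > 0 and K > 0 such that for every integer n ≥ 2, the probability that M_n is singular (i.e., has determinant zero as a rational matrix) is at most K·(log n)^C / n^{1/2}. -/
/-- The random symmetric ±1 matrix: the upper-triangular entries
(including diagonal) are determined by independent fair coin flips
`σ i j` for `i ≤ j`, and the matrix is symmetric. -/
def signMatrix (n : ℕ) (σ : Fin n → Fin n → Bool) : Matrix (Fin n) (Fin n) ℤ :=
  fun i j => if σ (min i j) (max i j) then 1 else -1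

/-- Probability, under the uniform distribution on symmetric ±1 matrices,
that the matrix satisfies `P`. -/
noncomputable def probSym (n : ℕ) (P : Matrix (Fin n) (Fin n) ℤ → Prop) : ℝ :=
  (Nat.card {σ : Fin n → Fin n → Bool // P (signMatrix n σ)} : ℝ) /
    Fintype.card (Fin n → Fin n → Bool)

section

open Finset

lemma stdAddChar_sum {p : ℕ} [NeZero p] {ι : Type*} (s : Finset ι) (f : ι → ZMod p) :
    ZMod.stdAddChar (∑ i ∈ s, f i) = ∏ i ∈ s, ZMod.stdAddChar (f i) :=
  map_prod (ZMod.stdAddChar (N := p)).toMonoidHom (fun i => Multiplicative.ofAdd (f i)) s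

lemma norm_stdAddChar_add_neg_le {p : ℕ} [NeZero p] (hp : Odd p) {x : ZMod p} (hx : x ≠ 0) :
    ‖ZMod.stdAddChar x + ZMod.stdAddChar (-x)‖ ≤ 2 * Real.exp (-(2 / (p : ℝ) ^ 2)) := by
  have hp0 : (0 : ℝ) < p := by exact_mod_cast Nat.pos_of_ne_zero (NeZero.ne p)
  set k : ℤ := x.valMinAbs with hk
  set θ : ℝ := 2 * Real.pi * k / p with hθ
  have hxk : x = (k : ZMod p) := (ZMod.coe_valMinAbs x).symm
  have hk0 : 1 ≤ |k| := by
    refine Int.one_le_abs fun h => hx ?_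
    rw [hxk, h, Int.cast_zero]
  have hk1 : 2 * |k| + 1 ≤ p := by
    have h := ZMod.natAbs_valMinAbs_le x
    rw [← hk] at h
    obtain ⟨m, hm⟩ := hp
    have h2 : |k| = (k.natAbs : ℤ) := Int.abs_eq_natAbs k
    omega
  have hsum : ZMod.stdAddChar x + ZMod.stdAddChar (-x) = ((2 * Real.cos θ : ℝ) : ℂ) := by
    have e : -x = ((-k : ℤ) : ZMod p) := by rw [hxk, Int.cast_neg]
    rw [e, hxk, ZMod.stdAddChar_coe, ZMod.stdAddChar_coe]
    push_cast
    rw [Complex.two_cos, hθ]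
    congr 2 <;> · push_cast; ring
  have hk0' : (1 : ℝ) ≤ |(k : ℝ)| := by exact_mod_cast hk0
  have hk1' : 2 * |(k : ℝ)| + 1 ≤ p := by exact_mod_cast hk1
  have habs : |θ| = Real.pi / p * (2 * |(k : ℝ)|) := by
    rw [hθ, abs_div, abs_mul, abs_of_pos hp0, abs_of_pos Real.two_pi_pos]; ring
  have hpp : 0 < Real.pi / p := by positivity
  have hpi : Real.pi = Real.pi / p * p := by field_simp
  have h1 : Real.pi / p ≤ |θ| := by rw [habs]; nlinarith
  have h2 : |θ| ≤ Real.pi - Real.pi / p := by rw [habs]; nlinarith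
  have hcos : |Real.cos θ| ≤ Real.cos (Real.pi / p) := by
    rw [← Real.cos_abs θ, abs_le']
    constructor
    · exact Real.cos_le_cos_of_nonneg_of_le_pi hpp.le (by linarith) h1
    · rw [← Real.cos_pi_sub]
      exact Real.cos_le_cos_of_nonneg_of_le_pi hpp.le (by linarith) (by linarith)
  have hquad := Real.cos_le_one_sub_mul_cos_sq (x := Real.pi / p) (by rw [abs_of_pos hpp]; linarith)
  have hexp := Real.add_one_le_exp (-(2 / (p : ℝ) ^ 2))
  have e2 : 2 / Real.pi ^ 2 * (Real.pi / p) ^ 2 = 2 / (p : ℝ) ^ 2 := by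
    have := Real.pi_ne_zero
    field_simp
  rw [hsum, Complex.norm_real, Real.norm_eq_abs, abs_mul, abs_two]
  linarith

lemma sum_stdAddChar_dotProduct {p : ℕ} [Fact p.Prime] {ι : Type*} [Fintype ι] [DecidableEq ι]
    (w : ι → ZMod p) :
    ∑ u : ι → ZMod p, ZMod.stdAddChar (u ⬝ᵥ w) =
      if w = 0 then (p : ℂ) ^ Fintype.card ι else 0 := by
  have h : ∀ i, ∑ t : ZMod p, ZMod.stdAddChar (t * w i) = if w i = 0 then (p : ℂ) else 0 := by
    intro i
    rw [AddChar.sum_mulShift _ (ZMod.isPrimitive_stdAddChar p), ZMod.card]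
    push_cast; rfl
  simp only [dotProduct, stdAddChar_sum]
  rw [← Fintype.piFinset_univ,
    Finset.sum_prod_piFinset univ fun i (t : ZMod p) => ZMod.stdAddChar (t * w i)]
  simp only [h]
  split_ifs with hw
  · simp [hw]
  · obtain ⟨i, hi⟩ := Function.ne_iff.1 hw
    exact Finset.prod_eq_zero (mem_univ i) (if_neg hi)

lemma sum_pow_hammingNorm {p : ℕ} [NeZero p] {ι : Type*} [Fintype ι] [DecidableEq ι] (q : ℝ) :
    ∑ u : ι → ZMod p, q ^ hammingNorm u = (1 + (p - 1) * q) ^ Fintype.card ι := by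
  have h : ∀ u : ι → ZMod p, q ^ hammingNorm u = ∏ i, if u i ≠ 0 then q else 1 := by
    intro u
    rw [hammingNorm, Finset.prod_ite, Finset.prod_const, Finset.prod_const_one, mul_one]
  have h1 : ∑ t : ZMod p, (if t ≠ 0 then q else 1) = 1 + (p - 1) * q := by
    rw [← Finset.add_sum_erase _ _ (mem_univ (0 : ZMod p)),
      Finset.sum_congr rfl fun t ht => if_pos (Finset.ne_of_mem_erase ht), Finset.sum_const,
      Finset.card_erase_of_mem (mem_univ _), Finset.card_univ, ZMod.card, nsmul_eq_mul,
      Nat.cast_sub (Nat.one_le_iff_ne_zero.2 (NeZero.ne p))]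
    simp
  simp only [h]
  rw [← Fintype.piFinset_univ,
    Finset.sum_prod_piFinset univ fun (_ : ι) (t : ZMod p) => if t ≠ 0 then q else 1]
  simp only [h1, Finset.prod_const, Finset.card_univ]

lemma card_add_eq_zero_le_card_eq {ι G : Type*} [AddCommGroup G] [Fintype G] [DecidableEq G]
    (X : Finset ι) (r : ι → G) :
    #{x ∈ X ×ˢ X | r x.1 + r x.2 = 0} ≤ #{x ∈ X ×ˢ X | r x.1 = r x.2} := by
  set N : G → ℕ := fun g => #{i ∈ X | r i = g} with hN
  have key : ∀ φ : G → G, #{x ∈ X ×ˢ X | r x.2 = φ (r x.1)} = ∑ g, N g * N (φ g) := by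
    intro φ
    rw [Finset.card_filter, Finset.sum_product]
    simp only [← Finset.card_filter]
    rw [← Finset.sum_fiberwise X r]
    refine Finset.sum_congr rfl fun g _ => ?_
    rw [Finset.sum_congr rfl (g := fun _ => N (φ g)), Finset.sum_const, smul_eq_mul]
    intro i hi
    rw [(Finset.mem_filter.1 hi).2]
  have e1 := key Neg.neg
  have e2 := key id
  simp only [eq_neg_iff_add_eq_zero, add_comm (r (Prod.snd _))] at e1
  simp only [id, eq_comm (a := r (Prod.snd _))] at e2
  rw [e1, e2]
  have h3 : ∑ g, N (-g) * N (-g) = ∑ g, N g * N g :=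
    Equiv.sum_comp (Equiv.neg G) fun g => N g * N g
  have h4 : 2 * ∑ g, N g * N (-g) ≤ ∑ g, N g * N g + ∑ g, N (-g) * N (-g) := by
    rw [Finset.mul_sum, ← Finset.sum_add_distrib]
    refine Finset.sum_le_sum fun g _ => ?_
    nlinarith [two_mul_le_add_sq (N g) (N (-g))]
  omega

lemma hammingNorm_mul_le_card {K ι : Type*} [Field K] [Fintype K] [DecidableEq K] [Fintype ι]
    (h2 : (2 : K) ≠ 0) (u v : ι → K) :
    hammingNorm u * hammingNorm v ≤ 2 * #{x : ι × ι | u x.1 * v x.2 + u x.2 * v x.1 ≠ 0} := by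
  classical
  set A : Finset ι := {i | u i ≠ 0} with hA
  set B : Finset ι := {i | v i ≠ 0} with hB
  set X : Finset ι := {i | u i ≠ 0 ∧ v i ≠ 0} with hX
  have hZ : #{x ∈ A ×ˢ B | u x.1 * v x.2 + u x.2 * v x.1 = 0} ≤
      #{x ∈ X ×ˢ X | v x.1 / u x.1 + v x.2 / u x.2 = 0} := by
    refine Finset.card_le_card fun x hx => ?_
    simp only [hA, hB, hX, mem_filter, mem_product, mem_univ, true_and] at hx ⊢
    obtain ⟨⟨hu, hv⟩, h⟩ := hx
    have hne : u x.2 * v x.1 ≠ 0 := by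
      intro h0
      rw [h0, add_zero] at h
      exact mul_ne_zero hu hv h
    have hu2 := left_ne_zero_of_mul hne
    have hv1 := right_ne_zero_of_mul hne
    refine ⟨⟨⟨hu, hv1⟩, hu2, hv⟩, ?_⟩
    rw [div_add_div _ _ hu hu2, div_eq_zero_iff]
    left
    linear_combination h
  have hE : #{x ∈ X ×ˢ X | v x.1 / u x.1 = v x.2 / u x.2} ≤
      #{x : ι × ι | u x.1 * v x.2 + u x.2 * v x.1 ≠ 0} := by
    refine Finset.card_le_card fun x hx => ?_
    simp only [hX, mem_filter, mem_product, mem_univ, true_and] at hx ⊢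
    obtain ⟨⟨⟨hu1, hv1⟩, hu2, hv2⟩, h⟩ := hx
    rw [div_eq_div_iff hu1 hu2] at h
    rw [show u x.1 * v x.2 + u x.2 * v x.1 = 2 * (u x.1 * v x.2) by linear_combination h]
    exact mul_ne_zero h2 (mul_ne_zero hu1 hv2)
  have hW : #{x ∈ A ×ˢ B | ¬ u x.1 * v x.2 + u x.2 * v x.1 = 0} ≤
      #{x : ι × ι | u x.1 * v x.2 + u x.2 * v x.1 ≠ 0} :=
    Finset.card_le_card (Finset.filter_subset_filter _ (Finset.subset_univ _))
  have hsplit := Finset.card_filter_add_card_filter_not (s := A ×ˢ B)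
    fun x => u x.1 * v x.2 + u x.2 * v x.1 = 0
  rw [Finset.card_product] at hsplit
  have hmid := card_add_eq_zero_le_card_eq X fun i => v i / u i
  change #A * #B ≤ _
  omega

/-- Coefficient of the `(i, j)` sign in the bilinear form `u ⬝ᵥ M *ᵥ v` of a symmetric matrix `M`
parametrized by its upper triangle. -/
def upperCoeff {n : ℕ} {R : Type*} [Semiring R] (u v : Fin n → R) (i j : Fin n) : R :=
  if i < j then u i * v j + u j * v i else if i = j then u i * v i else 0

lemma dotProduct_signMatrix_mulVec {n : ℕ} {R : Type*} [CommRing R] (σ : Fin n → Fin n → Bool)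
    (u v : Fin n → R) :
    u ⬝ᵥ ((signMatrix n σ).map (Int.cast : ℤ → R)).mulVec v =
      ∑ i, ∑ j, (if σ i j then upperCoeff u v i j else -upperCoeff u v i j) := by
  have hswap : ∀ F : Fin n → Fin n → R, ∑ i, ∑ j, F i j =
      ∑ i, ∑ j, ((if i < j then F i j + F j i else 0) + if i = j then F i i else 0) := by
    intro F
    have h1 : ∑ i, ∑ j, (if i < j then F j i else 0) = ∑ i, ∑ j, if j < i then F i j else 0 :=
      Finset.sum_comm
    have h2 : ∀ i j : Fin n, (if i < j then F i j + F j i else 0) =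
        (if i < j then F i j else 0) + if i < j then F j i else 0 := by
      intro i j; split_ifs <;> simp
    simp only [h2, Finset.sum_add_distrib, h1]
    simp only [← Finset.sum_add_distrib]
    refine Finset.sum_congr rfl fun i _ => Finset.sum_congr rfl fun j _ => ?_
    rcases lt_trichotomy i j with h | rfl | h
    · simp [h, h.not_gt, h.ne]
    · simp
    · simp [h, h.not_gt, h.ne']
  simp only [dotProduct, Matrix.mulVec, Finset.mul_sum]
  rw [hswap]
  refine Finset.sum_congr rfl fun i _ => Finset.sum_congr rfl fun j _ => ?_
  rcases lt_trichotomy i j with h | rfl | h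
  · simp only [upperCoeff, signMatrix, Matrix.map_apply, h, h.ne, if_true, if_false,
      min_eq_left h.le, max_eq_right h.le, min_eq_right h.le, max_eq_left h.le]
    split_ifs <;> push_cast <;> ring
  · simp only [upperCoeff, signMatrix, Matrix.map_apply, lt_irrefl, if_true, if_false, min_self,
      max_self]
    split_ifs <;> push_cast <;> ring
  · simp [upperCoeff, h.not_gt, h.ne']

lemma card_ne_zero_le_two_mul_card_upperCoeff {n : ℕ} {K : Type*} [Field K] [DecidableEq K]
    (u v : Fin n → K) :
    #{x : Fin n × Fin n | u x.1 * v x.2 + u x.2 * v x.1 ≠ 0} ≤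
      2 * #{x : Fin n × Fin n | upperCoeff u v x.1 x.2 ≠ 0} := by
  set S : Finset (Fin n × Fin n) := {x | upperCoeff u v x.1 x.2 ≠ 0} with hS
  have hsub : ({x | u x.1 * v x.2 + u x.2 * v x.1 ≠ 0} : Finset (Fin n × Fin n)) ⊆
      S ∪ S.image Prod.swap := by
    rintro ⟨i, j⟩ hx
    simp only [mem_filter, mem_univ, true_and] at hx
    simp only [hS, mem_union, mem_image, mem_filter, mem_univ, true_and]
    rcases lt_trichotomy i j with h | rfl | h
    · left; simpa [upperCoeff, h] using hx
    · left
      intro h0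
      simp only [upperCoeff, lt_irrefl, if_true, if_false] at h0
      exact hx (by rw [h0, add_zero])
    · refine Or.inr ⟨(j, i), ?_, rfl⟩
      simpa [upperCoeff, h, add_comm] using hx
  have h1 := Finset.card_le_card hsub
  have h2 := Finset.card_union_le S (S.image Prod.swap)
  have h3 : #(S.image Prod.swap) ≤ #S := Finset.card_image_le
  omega

lemma norm_sum_stdAddChar_signMatrix_le {n p : ℕ} [Fact p.Prime] (hp : Odd p)
    (u v : Fin n → ZMod p) :
    ‖∑ σ : Fin n → Fin n → Bool, ZMod.stdAddChar
        (u ⬝ᵥ ((signMatrix n σ).map (Int.cast : ℤ → ZMod p)).mulVec v)‖ ≤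
      2 ^ (n * n) * Real.exp (-(hammingNorm u * hammingNorm v / (2 * (p : ℝ) ^ 2))) := by
  set B := upperCoeff u v with hB
  have hprod : ∑ σ : Fin n → Fin n → Bool, ZMod.stdAddChar
        (u ⬝ᵥ ((signMatrix n σ).map (Int.cast : ℤ → ZMod p)).mulVec v) =
      ∏ i, ∏ j, (ZMod.stdAddChar (B i j) + ZMod.stdAddChar (-B i j)) := by
    simp only [dotProduct_signMatrix_mulVec, stdAddChar_sum]
    have h1 : ∀ i j, ZMod.stdAddChar (B i j) + ZMod.stdAddChar (-B i j) =
        ∑ b : Bool, ZMod.stdAddChar (if b then B i j else -B i j) := by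
      intro i j; simp
    simp only [h1, Finset.prod_univ_sum, Fintype.piFinset_univ]
    rfl
  have hterm : ∀ x : Fin n × Fin n,
      ‖ZMod.stdAddChar (B x.1 x.2) + ZMod.stdAddChar (-B x.1 x.2)‖ ≤
        2 * if B x.1 x.2 ≠ 0 then Real.exp (-(2 / (p : ℝ) ^ 2)) else 1 := by
    intro x
    split_ifs with h
    · exact norm_stdAddChar_add_neg_le hp h
    · rw [not_not] at h
      rw [h]
      norm_num
  have h2 : (2 : ZMod p) ≠ 0 := by
    have : Fact (2 < p) := ⟨by
      have := (Fact.out : p.Prime).two_le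
      rcases hp with ⟨m, rfl⟩; omega⟩
    exact_mod_cast ZMod.prime_ne_zero p 2 (by have := this.out; omega)
  have hcount : hammingNorm u * hammingNorm v ≤
      4 * #{x : Fin n × Fin n | B x.1 x.2 ≠ 0} := by
    have := hammingNorm_mul_le_card h2 u v
    have := card_ne_zero_le_two_mul_card_upperCoeff u v
    rw [hB]
    omega
  have hcount' : (hammingNorm u * hammingNorm v : ℝ) ≤
      4 * (#{x : Fin n × Fin n | B x.1 x.2 ≠ 0} : ℝ) := by exact_mod_cast hcount
  rw [hprod, ← Fintype.prod_prod_type' fun i j =>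
    (ZMod.stdAddChar (B i j) + ZMod.stdAddChar (-B i j)), norm_prod]
  refine (Finset.prod_le_prod (fun _ _ => norm_nonneg _) fun x _ => hterm x).trans ?_
  rw [Finset.prod_mul_distrib, Finset.prod_const, Finset.prod_ite, Finset.prod_const,
    Finset.prod_const_one, mul_one, Finset.card_univ, Fintype.card_prod, Fintype.card_fin,
    ← Real.exp_nat_mul]
  refine mul_le_mul_of_nonneg_left (Real.exp_le_exp.2 ?_) (by positivity)
  have hp0 : (0 : ℝ) < p := by exact_mod_cast (Fact.out : p.Prime).pos
  rw [mul_neg, neg_le_neg_iff, mul_div_assoc', div_le_div_iff₀ (by positivity) (by positivity)]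
  nlinarith [sq_nonneg (p : ℝ)]

lemma le_card_kernel {n p : ℕ} [Fact p.Prime] {M : Matrix (Fin n) (Fin n) (ZMod p)}
    (hM : M.det = 0) : p ≤ #{v : Fin n → ZMod p | M.mulVec v = 0} := by
  obtain ⟨v, hv, hMv⟩ := Matrix.exists_mulVec_eq_zero_iff.2 hM
  calc p = #(univ : Finset (ZMod p)) := by rw [Finset.card_univ, ZMod.card]
    _ ≤ _ := Finset.card_le_card_of_injOn (fun t => t • v)
      (fun t _ => by simp [Matrix.mulVec_smul, hMv])
      ((smul_left_injective (ZMod p) hv).injOn)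

lemma card_singular_mul_le {n p : ℕ} [Fact p.Prime] (hp : Odd p) :
    (#{σ : Fin n → Fin n → Bool | ((signMatrix n σ).map (Int.cast : ℤ → ℚ)).det = 0} : ℝ) *
        (p * (p : ℝ) ^ n) ≤
      2 ^ (n * n) * ∑ u : Fin n → ZMod p, ∑ v : Fin n → ZMod p,
        Real.exp (-(hammingNorm u * hammingNorm v / (2 * (p : ℝ) ^ 2))) := by
  set M : (Fin n → Fin n → Bool) → Matrix (Fin n) (Fin n) (ZMod p) :=
    fun σ => (signMatrix n σ).map (Int.cast : ℤ → ZMod p) with hM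
  have hdet : ∀ σ, ((signMatrix n σ).map (Int.cast : ℤ → ℚ)).det = 0 → (M σ).det = 0 := by
    intro σ h
    have h1 : (((signMatrix n σ).det : ℤ) : ℚ) = 0 := by
      rw [← h]; exact (Int.castRingHom ℚ).map_det _
    have h2 : (((signMatrix n σ).det : ℤ) : ZMod p) = (M σ).det :=
      (Int.castRingHom (ZMod p)).map_det _
    rw [← h2, Int.cast_eq_zero.1 h1, Int.cast_zero]
  have h1 : #{σ : Fin n → Fin n → Bool | ((signMatrix n σ).map (Int.cast : ℤ → ℚ)).det = 0} * p ≤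
      ∑ σ, #{v : Fin n → ZMod p | (M σ).mulVec v = 0} := by
    refine le_trans ?_ (Finset.sum_le_sum_of_subset (Finset.filter_subset
      (fun σ => ((signMatrix n σ).map (Int.cast : ℤ → ℚ)).det = 0) univ))
    rw [← smul_eq_mul]
    exact Finset.card_nsmul_le_sum _ _ _ fun σ hσ =>
      le_card_kernel (hdet σ (Finset.mem_filter.1 hσ).2)
  have h2 : ((∑ σ, #{v : Fin n → ZMod p | (M σ).mulVec v = 0} : ℕ) : ℂ) * (p : ℂ) ^ n =
      ∑ u : Fin n → ZMod p, ∑ v : Fin n → ZMod p, ∑ σ,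
        ZMod.stdAddChar (u ⬝ᵥ (M σ).mulVec v) := by
    have e : ∀ σ, ((#{v : Fin n → ZMod p | (M σ).mulVec v = 0} : ℕ) : ℂ) * (p : ℂ) ^ n =
        ∑ v : Fin n → ZMod p, ∑ u : Fin n → ZMod p,
          ZMod.stdAddChar (u ⬝ᵥ (M σ).mulVec v) := by
      intro σ
      simp only [sum_stdAddChar_dotProduct, Fintype.card_fin]
      rw [← Finset.sum_filter, Finset.sum_const, nsmul_eq_mul]
    rw [Nat.cast_sum, Finset.sum_mul]
    simp only [e]
    rw [Finset.sum_comm, Finset.sum_congr rfl fun v _ => Finset.sum_comm]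
    exact Finset.sum_comm
  have h3 : ((∑ σ, #{v : Fin n → ZMod p | (M σ).mulVec v = 0} : ℕ) : ℝ) * (p : ℝ) ^ n ≤
      ∑ u : Fin n → ZMod p, ∑ v : Fin n → ZMod p, 2 ^ (n * n) *
        Real.exp (-(hammingNorm u * hammingNorm v / (2 * (p : ℝ) ^ 2))) := by
    calc _ = ‖((∑ σ, #{v : Fin n → ZMod p | (M σ).mulVec v = 0} : ℕ) : ℂ) * (p : ℂ) ^ n‖ := by
          rw [norm_mul, norm_pow, Complex.norm_natCast, Complex.norm_natCast]
      _ ≤ _ := by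
          rw [h2]
          refine (norm_sum_le _ _).trans (Finset.sum_le_sum fun u _ => ?_)
          refine (norm_sum_le _ _).trans (Finset.sum_le_sum fun v _ => ?_)
          exact norm_sum_stdAddChar_signMatrix_le hp u v
  have h1' : (#{σ : Fin n → Fin n → Bool |
      ((signMatrix n σ).map (Int.cast : ℤ → ℚ)).det = 0} : ℝ) * p ≤
      ((∑ σ, #{v : Fin n → ZMod p | (M σ).mulVec v = 0} : ℕ) : ℝ) := by exact_mod_cast h1
  simp only [← Finset.mul_sum] at h3
  rw [← mul_assoc]
  exact (mul_le_mul_of_nonneg_right h1' (by positivity)).trans h3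

/-- There are few vectors whose support has size at most a quarter of the dimension. -/
lemma card_small_support_sq_le {n p : ℕ} [NeZero p] (hp : 16 ≤ p) :
    (#{u : Fin n → ZMod p | 4 * hammingNorm u ≤ n} : ℝ) ^ 2 ≤ (p : ℝ) ^ n := by
  have hp0 : (0 : ℝ) < p := by positivity
  have hp16 : (16 : ℝ) ≤ p := by exact_mod_cast hp
  set m := n / 4 with hm
  have h1 : (#{u : Fin n → ZMod p | 4 * hammingNorm u ≤ n} : ℝ) ≤ p ^ m * 2 ^ n := by
    calc (#{u : Fin n → ZMod p | 4 * hammingNorm u ≤ n} : ℝ)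
        = ∑ u : Fin n → ZMod p with 4 * hammingNorm u ≤ n, (1 : ℝ) := by simp
      _ ≤ ∑ u : Fin n → ZMod p with 4 * hammingNorm u ≤ n,
          (p : ℝ) ^ m * ((p : ℝ)⁻¹) ^ hammingNorm u := by
          refine Finset.sum_le_sum fun u hu => ?_
          have hu' : hammingNorm u ≤ m := by
            have := (Finset.mem_filter.1 hu).2; omega
          rw [inv_pow, ← div_eq_mul_inv, one_le_div (by positivity)]
          exact pow_le_pow_right₀ (by linarith) hu'
      _ ≤ ∑ u : Fin n → ZMod p, (p : ℝ) ^ m * ((p : ℝ)⁻¹) ^ hammingNorm u :=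
          Finset.sum_le_sum_of_subset_of_nonneg (Finset.filter_subset _ _)
            fun _ _ _ => by positivity
      _ ≤ p ^ m * 2 ^ n := by
          rw [← Finset.mul_sum, sum_pow_hammingNorm, Fintype.card_fin]
          have : 0 < (p : ℝ)⁻¹ := by positivity
          have e : (1 + ((p : ℝ) - 1) * (p : ℝ)⁻¹) = 2 - (p : ℝ)⁻¹ := by field_simp; ring
          have e1 : (p : ℝ)⁻¹ ≤ 1 := inv_le_one_of_one_le₀ (by linarith)
          rw [e]
          gcongr <;> linarith
  calc (#{u : Fin n → ZMod p | 4 * hammingNorm u ≤ n} : ℝ) ^ 2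
      ≤ ((p : ℝ) ^ m * 2 ^ n) ^ 2 := by gcongr
    _ = (p : ℝ) ^ (2 * m) * 4 ^ n := by
        rw [mul_pow, ← pow_mul, ← pow_mul, mul_comm m, mul_comm n, pow_mul 2 2 n]; norm_num
    _ ≤ (p : ℝ) ^ (2 * m) * 4 ^ (2 * (n - 2 * m)) := by
        gcongr
        · norm_num
        · omega
    _ = (p : ℝ) ^ (2 * m) * 16 ^ (n - 2 * m) := by rw [pow_mul 4 2]; norm_num
    _ ≤ (p : ℝ) ^ (2 * m) * (p : ℝ) ^ (n - 2 * m) := by gcongr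
    _ = (p : ℝ) ^ n := by rw [← pow_add]; congr 1; omega

lemma sum_exp_large_support_le {n p : ℕ} [NeZero p]
    (hq : n * (p * Real.exp (-(n / (8 * (p : ℝ) ^ 2)))) ≤ 1) :
    ∑ u : Fin n → ZMod p with ¬ 4 * hammingNorm u ≤ n, ∑ v : Fin n → ZMod p,
      Real.exp (-(hammingNorm u * hammingNorm v / (2 * (p : ℝ) ^ 2))) ≤ 3 * (p : ℝ) ^ n := by
  have hp0 : (0 : ℝ) < p := by exact_mod_cast Nat.pos_of_ne_zero (NeZero.ne p)
  set q := Real.exp (-(n / (8 * (p : ℝ) ^ 2))) with hqdef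
  have hq0 : 0 < q := Real.exp_pos _
  have hinner : ∀ u : Fin n → ZMod p, ¬ 4 * hammingNorm u ≤ n → ∑ v : Fin n → ZMod p,
      Real.exp (-(hammingNorm u * hammingNorm v / (2 * (p : ℝ) ^ 2))) ≤ 3 := by
    intro u hu
    have hu' : (n : ℝ) ≤ 4 * hammingNorm u := by exact_mod_cast (not_le.1 hu).le
    calc _ ≤ ∑ v : Fin n → ZMod p, q ^ hammingNorm v := by
          refine Finset.sum_le_sum fun v _ => ?_
          rw [hqdef, ← Real.exp_nat_mul]
          refine Real.exp_le_exp.2 ?_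
          rw [mul_neg, neg_le_neg_iff, mul_div_assoc',
            div_le_div_iff₀ (by positivity) (by positivity)]
          have : (0 : ℝ) ≤ hammingNorm v * (p : ℝ) ^ 2 := by positivity
          nlinarith
      _ = (1 + (p - 1) * q) ^ n := by rw [sum_pow_hammingNorm, Fintype.card_fin]
      _ ≤ Real.exp (p * q) ^ n := by
          have h1 : (1 : ℝ) ≤ p := by exact_mod_cast Nat.one_le_iff_ne_zero.2 (NeZero.ne p)
          have h2 := Real.add_one_le_exp (p * q)
          have h3 : 0 ≤ ((p : ℝ) - 1) * q := mul_nonneg (by linarith) hq0.le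
          gcongr
          linarith
      _ = Real.exp (n * (p * q)) := by rw [← Real.exp_nat_mul]
      _ ≤ Real.exp 1 := Real.exp_le_exp.2 hq
      _ ≤ 3 := by have := Real.exp_one_lt_d9; linarith
  calc _ ≤ ∑ u : Fin n → ZMod p with ¬ 4 * hammingNorm u ≤ n, (3 : ℝ) :=
        Finset.sum_le_sum fun u hu => hinner u (Finset.mem_filter.1 hu).2
    _ ≤ ∑ u : Fin n → ZMod p, (3 : ℝ) :=
        Finset.sum_le_sum_of_subset_of_nonneg (Finset.filter_subset _ _) fun _ _ _ => by norm_num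
    _ = 3 * (p : ℝ) ^ n := by simp [ZMod.card, mul_comm]

lemma sum_sum_exp_hammingNorm_le {n p : ℕ} [NeZero p] (hp : 16 ≤ p)
    (hq : n * (p * Real.exp (-(n / (8 * (p : ℝ) ^ 2)))) ≤ 1) :
    ∑ u : Fin n → ZMod p, ∑ v : Fin n → ZMod p,
      Real.exp (-(hammingNorm u * hammingNorm v / (2 * (p : ℝ) ^ 2))) ≤ 7 * (p : ℝ) ^ n := by
  set F : (Fin n → ZMod p) → (Fin n → ZMod p) → ℝ := fun u v =>
    Real.exp (-(hammingNorm u * hammingNorm v / (2 * (p : ℝ) ^ 2))) with hF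
  set S : Finset (Fin n → ZMod p) := {u | 4 * hammingNorm u ≤ n} with hS
  have hcomm : ∀ u v, F u v = F v u := fun u v => by
    simp only [hF, mul_comm (hammingNorm u : ℝ)]
  have h1 : ∑ u with ¬ 4 * hammingNorm u ≤ n, ∑ v, F u v ≤ 3 * (p : ℝ) ^ n :=
    sum_exp_large_support_le hq
  have h2 : ∑ u ∈ S, ∑ v with ¬ 4 * hammingNorm v ≤ n, F u v ≤ 3 * (p : ℝ) ^ n := by
    rw [Finset.sum_comm]
    refine le_trans (Finset.sum_le_sum fun v _ => ?_) h1
    simp only [hcomm _ v]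
    exact Finset.sum_le_sum_of_subset_of_nonneg (Finset.subset_univ _)
      fun _ _ _ => (Real.exp_pos _).le
  have h3 : ∑ u ∈ S, ∑ v ∈ S, F u v ≤ (p : ℝ) ^ n := by
    refine le_trans ?_ (card_small_support_sq_le (n := n) hp)
    calc ∑ u ∈ S, ∑ v ∈ S, F u v ≤ ∑ u ∈ S, ∑ v ∈ S, (1 : ℝ) :=
          Finset.sum_le_sum fun u _ => Finset.sum_le_sum fun v _ =>
            Real.exp_le_one_iff.2 (neg_nonpos.2 (by positivity))
      _ = (#S : ℝ) ^ 2 := by simp [sq]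
  have h4 : ∑ u ∈ S, ∑ v, F u v =
      ∑ u ∈ S, ∑ v ∈ S, F u v + ∑ u ∈ S, ∑ v with ¬ 4 * hammingNorm v ≤ n, F u v := by
    rw [← Finset.sum_add_distrib]
    exact Finset.sum_congr rfl fun u _ => (Finset.sum_filter_add_sum_filter_not _ _ _).symm
  have h5 := Finset.sum_filter_add_sum_filter_not univ
    (fun u : Fin n → ZMod p => 4 * hammingNorm u ≤ n) fun u => ∑ v, F u v
  rw [← h5]
  linarith

lemma probSym_singular_le_div_prime {n p : ℕ} [Fact p.Prime] (hp : 16 ≤ p)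
    (hq : n * (p * Real.exp (-(n / (8 * (p : ℝ) ^ 2)))) ≤ 1) :
    probSym n (fun M => (M.map (Int.cast : ℤ → ℚ)).det = 0) ≤ 7 / p := by
  have hp0 : (0 : ℝ) < p := by exact_mod_cast (Fact.out : p.Prime).pos
  have hodd : Odd p := (Fact.out : p.Prime).odd_of_ne_two (by omega)
  have h := (card_singular_mul_le (n := n) hodd).trans
    (mul_le_mul_of_nonneg_left (sum_sum_exp_hammingNorm_le hp hq) (by positivity))
  have hcard : (Fintype.card (Fin n → Fin n → Bool) : ℝ) = 2 ^ (n * n) := by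
    simp [← pow_mul]
  rw [probSym, hcard, Nat.card_eq_fintype_card, Fintype.card_subtype,
    div_le_div_iff₀ (by positivity) hp0]
  refine le_of_mul_le_mul_right ?_ (pow_pos hp0 n)
  linarith

lemma probSym_le_one (n : ℕ) (P : Matrix (Fin n) (Fin n) ℤ → Prop) : probSym n P ≤ 1 := by
  classical
  rw [probSym, Nat.card_eq_fintype_card]
  exact div_le_one_of_le₀ (by exact_mod_cast Fintype.card_subtype_le _) (by positivity)

end

/-- There exist constants `C > 0` and `K > 0` such that for every integer `n ≥ 2`,
the probability that a uniformly random `n × n` symmetric `±1` matrix is singular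
(over `ℚ`) is at most `K · (log n)^C / n^(1/2)`. -/
theorem singular_prob_bound :
    ∃ C > (0 : ℝ), ∃ K > (0 : ℝ), ∀ n : ℕ, 2 ≤ n →
      probSym n (fun M => (M.map (Int.cast : ℤ → ℚ)).det = 0)
        ≤ K * (Real.log n) ^ C / Real.sqrt n := by
  refine ⟨1 / 2, by norm_num, 128, by norm_num, fun n hn => ?_⟩
  have hn2 : (2 : ℝ) ≤ n := by exact_mod_cast hn
  have hn0 : (0 : ℝ) < n := by linarith
  set L := Real.log n with hL
  have hLhalf : 1 / 2 ≤ L := by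
    have h1 := Real.log_le_log (by norm_num) hn2
    have h2 := Real.log_two_gt_d9
    linarith
  have hL0 : 0 < L := by linarith
  rw [← Real.sqrt_eq_rpow, mul_div_assoc]
  have hs : 0 < √L := Real.sqrt_pos.2 hL0
  have hsn : 0 < √(n : ℝ) := Real.sqrt_pos.2 hn0
  set t := √(n : ℝ) / (8 * √L) with ht
  have ht0 : 0 < t := by positivity
  have hinv : √L / √(n : ℝ) = 1 / (8 * t) := by rw [ht]; field_simp
  rw [hinv]
  rcases lt_or_ge t 16 with hlt | hge
  · refine (probSym_le_one _ _).trans ?_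
    rw [mul_one_div, le_div_iff₀ (by positivity)]
    linarith
  · have hfloor : ⌊t⌋₊ ≠ 0 := (Nat.floor_pos.2 (by linarith)).ne'
    obtain ⟨p, hp, hlo, hhi⟩ := Nat.exists_prime_lt_and_le_two_mul ⌊t⌋₊ hfloor
    have := Fact.mk hp
    have htp : t < p := (Nat.floor_lt ht0.le).1 hlo
    have hpt : (p : ℝ) ≤ 2 * t := by
      have h1 : (p : ℝ) ≤ 2 * (⌊t⌋₊ : ℝ) := by exact_mod_cast hhi
      have h2 := Nat.floor_le ht0.le
      linarith
    have hp16 : 16 ≤ p := by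
      have : (16 : ℝ) < p := by linarith
      exact_mod_cast this.le
    have hp0 : (0 : ℝ) < p := by linarith
    have htsq : t ^ 2 * (64 * L) = n := by
      rw [ht, div_pow, mul_pow, Real.sq_sqrt hn0.le, Real.sq_sqrt hL0.le]
      field_simp
      norm_num
    have hpsq : (p : ℝ) ^ 2 * (16 * L) ≤ n := by
      have : (p : ℝ) ^ 2 ≤ (2 * t) ^ 2 := by gcongr
      nlinarith
    have hpn : (p : ℝ) ≤ n := by nlinarith [sq_nonneg (p : ℝ)]
    have hq : n * (p * Real.exp (-(n / (8 * (p : ℝ) ^ 2)))) ≤ 1 := by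
      have h1 : 2 * L ≤ n / (8 * (p : ℝ) ^ 2) := by
        rw [le_div_iff₀ (by positivity)]
        linarith
      have h2 : Real.exp (-(n / (8 * (p : ℝ) ^ 2))) ≤ ((n : ℝ) * n)⁻¹ := by
        calc _ ≤ Real.exp (-(L + L)) := Real.exp_le_exp.2 (by linarith)
          _ = ((n : ℝ) * n)⁻¹ := by rw [Real.exp_neg, Real.exp_add, hL, Real.exp_log hn0]
      calc n * (p * Real.exp (-(n / (8 * (p : ℝ) ^ 2)))) ≤ n * (n * ((n : ℝ) * n)⁻¹) := by gcongr
        _ = 1 := by field_simp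
    refine (probSym_singular_le_div_prime hp16 hq).trans ?_
    rw [mul_one_div, div_le_div_iff₀ hp0 (by positivity)]
    linarith
end

section
/- There exists a constant C > 0 such that for every ε > 0 there exists N such that for all n ≥ N and every odd prime q with q ≤ n^{1/2}/(log n)^C, the probability that M_n, with entries reduced modulo q, is singular as a matrix over the field ℤ/qℤ is at most (2 + ε)/q. -/
section SignMatrices

open Finset BigOperators Matrix

section Corank

variable {F : Type*} [Field F] {m : ℕ}

/-- The dimension of the kernel of a square matrix. -/
noncomputable def corank (M : Matrix (Fin m) (Fin m) F) : ℕ :=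
  Module.finrank F (LinearMap.ker M.mulVecLin)

/-- `B` is the symmetric bordering of `M` by the column `x` and the diagonal entry `d`. -/
structure IsBordering (B : Matrix (Fin (m + 1)) (Fin (m + 1)) F) (M : Matrix (Fin m) (Fin m) F)
    (x : Fin m → F) (d : F) : Prop where
  block : ∀ i j, B i.castSucc j.castSucc = M i j
  col : ∀ i, B i.castSucc (Fin.last m) = x i
  row : ∀ i, B (Fin.last m) i.castSucc = x i
  corner : B (Fin.last m) (Fin.last m) = d

variable {B : Matrix (Fin (m + 1)) (Fin (m + 1)) F} {M : Matrix (Fin m) (Fin m) F}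
  {x : Fin m → F} {d : F}

theorem IsBordering.mulVec_eq_zero_iff (h : IsBordering B M x d) (u : Fin (m + 1) → F) :
    B *ᵥ u = 0 ↔ M *ᵥ (Fin.init u) + u (Fin.last m) • x = 0 ∧
      x ⬝ᵥ Fin.init u + u (Fin.last m) * d = 0 := by
  rw [funext_iff, Fin.forall_fin_succ', funext_iff]
  simp [mulVec, dotProduct, Fin.sum_univ_castSucc, h.block, h.col, h.row, h.corner, Fin.init,
    mul_comm]

theorem corank_eq_zero_iff : corank M = 0 ↔ M.det ≠ 0 := by
  rw [corank, Submodule.finrank_eq_zero, ← isUnit_iff_ne_zero, ← Matrix.isUnit_iff_isUnit_det,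
    LinearMap.ker_eq_bot, ← Matrix.mulVec_injective_iff_isUnit]
  rfl

theorem corank_le : corank M ≤ m := by
  simpa [corank] using Submodule.finrank_le (LinearMap.ker M.mulVecLin)

theorem IsBordering.corank_le_succ (h : IsBordering B M x d) : corank B ≤ corank M + 1 := by
  let K := LinearMap.ker B.mulVecLin
  let t : K →ₗ[F] F := (LinearMap.proj (Fin.last m)).comp K.subtype
  let g : LinearMap.ker t →ₗ[F] LinearMap.ker M.mulVecLin :=
    LinearMap.codRestrict _ (((LinearMap.funLeft F F Fin.castSucc).comp K.subtype).comp
      (LinearMap.ker t).subtype) (by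
        rintro ⟨⟨u, hu⟩, ht⟩
        have ht : u (Fin.last m) = 0 := ht
        have := ((h.mulVec_eq_zero_iff u).1 hu).1
        rw [ht, zero_smul, add_zero] at this
        exact this)
  have hg : Function.Injective g := by
    rintro ⟨⟨u, hu⟩, htu⟩ ⟨⟨w, hw⟩, htw⟩ h0
    have htu : u (Fin.last m) = 0 := htu
    have htw : w (Fin.last m) = 0 := htw
    have h0 : Fin.init u = Fin.init w := congrArg Subtype.val h0
    ext i
    exact Fin.lastCases (htu.trans htw.symm) (fun i => congrFun h0 i) i
  have h1 := LinearMap.finrank_le_finrank_of_injective hg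
  have h2 := LinearMap.finrank_range_add_finrank_ker t
  have h3 := Submodule.finrank_le (LinearMap.range t)
  rw [Module.finrank_self] at h3
  change Module.finrank F K ≤ Module.finrank F _ + 1
  omega

theorem IsBordering.corank_lt (h : IsBordering B M x d) (hM : M.IsSymm) {v : Fin m → F}
    (hv : M *ᵥ v = 0) (hxv : v ⬝ᵥ x ≠ 0) : corank B < corank M := by
  let K := LinearMap.ker B.mulVecLin
  have key : ∀ u, B *ᵥ u = 0 → u (Fin.last m) = 0 := by
    intro u hu
    have := congrArg (v ⬝ᵥ ·) ((h.mulVec_eq_zero_iff u).1 hu).1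
    simp only [dotProduct_add, dotProduct_mulVec, dotProduct_smul, dotProduct_zero] at this
    rw [← mulVec_transpose, hM.eq, hv, zero_dotProduct, zero_add, smul_eq_mul] at this
    exact (mul_eq_zero.1 this).resolve_right hxv
  let g : K →ₗ[F] (Fin m → F) := (LinearMap.funLeft F F Fin.castSucc).comp K.subtype
  have hg : Function.Injective g := by
    refine (injective_iff_map_eq_zero g).2 ?_
    rintro ⟨u, hu⟩ h0
    have h0 : Fin.init u = 0 := h0
    ext i
    refine Fin.lastCases (key u hu) (fun i => congrFun h0 i) i
  have hlt : LinearMap.range g < LinearMap.ker M.mulVecLin := by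
    refine lt_of_le_of_ne ?_ ?_
    · rintro _ ⟨⟨u, hu⟩, rfl⟩
      have := ((h.mulVec_eq_zero_iff u).1 hu).1
      rw [key u hu, zero_smul, add_zero] at this
      exact this
    · intro heq
      have : v ∈ LinearMap.range g := heq ▸ hv
      obtain ⟨⟨u, hu⟩, rfl⟩ := this
      have := ((h.mulVec_eq_zero_iff u).1 hu).2
      rw [key u hu, zero_mul, add_zero, dotProduct_comm] at this
      exact hxv this
  have := Submodule.finrank_lt_finrank_of_lt hlt
  rwa [LinearMap.finrank_range_of_inj hg] at this

theorem IsBordering.corank_eq_zero (h : IsBordering B M x d) (hM : M.det ≠ 0)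
    (hd : x ⬝ᵥ (M⁻¹ *ᵥ x) ≠ d) : corank B = 0 := by
  rw [corank, Submodule.finrank_eq_zero, LinearMap.ker_eq_bot']
  intro u hu
  obtain ⟨h1, h2⟩ := (h.mulVec_eq_zero_iff u).1 hu
  have hinit : Fin.init u = -(u (Fin.last m) • (M⁻¹ *ᵥ x)) := by
    have := congrArg (M⁻¹ *ᵥ ·) h1
    simp only [mulVec_add, mulVec_mulVec, mulVec_zero, mulVec_smul] at this
    rw [Matrix.nonsing_inv_mul _ (isUnit_iff_ne_zero.2 hM), one_mulVec] at this
    exact eq_neg_of_add_eq_zero_left this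
  have ht : u (Fin.last m) = 0 := by
    rw [hinit, dotProduct_neg, dotProduct_smul, smul_eq_mul, ← sub_eq_neg_add, ← mul_sub] at h2
    exact (mul_eq_zero.1 h2).resolve_right (sub_ne_zero.2 hd.symm)
  rw [ht, zero_smul, neg_zero] at hinit
  ext i
  exact Fin.lastCases ht (fun i => congrFun hinit i) i

end Corank

/-- The sign `1` or `-1` encoded by a Boolean. -/
def boolSign (R : Type*) [Ring R] (b : Bool) : R := if b then 1 else -1

section Fourier

variable {q : ℕ} [Fact q.Prime]

theorem norm_stdAddChar (a : ZMod q) : ‖ZMod.stdAddChar a‖ = 1 := by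
  rw [ZMod.stdAddChar_apply, Circle.norm_coe]

theorem norm_stdAddChar_add_neg_le_s15 (hq : q ≠ 2) {a : ZMod q} (ha : a ≠ 0) :
    ‖(ZMod.stdAddChar a + ZMod.stdAddChar (-a)) / 2‖ ≤ Real.exp (-2 / q ^ 2) := by
  have hqp : (0 : ℝ) < q := by exact_mod_cast (Fact.out : q.Prime).pos
  have h2 : (2 : ZMod q) ≠ 0 := by
    intro h
    have : ((2 : ℕ) : ZMod q) = 0 := by exact_mod_cast h
    rw [ZMod.natCast_eq_zero_iff] at this
    exact hq ((Nat.prime_dvd_prime_iff_eq Fact.out Nat.prime_two).1 this)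
  set b : ZMod q := 2 * a with hb
  have hb0 : b ≠ 0 := mul_ne_zero h2 ha
  have hfac : ZMod.stdAddChar a + ZMod.stdAddChar (-a)
      = ZMod.stdAddChar (-a) * (ZMod.stdAddChar b + 1) := by
    rw [mul_add, mul_one, ← AddChar.map_add_eq_mul]
    congr 2
    rw [hb]; ring
  set r := b.val with hr
  have hr0 : 0 < r := Nat.pos_of_ne_zero (by simpa [hr, ZMod.val_eq_zero] using hb0)
  have hrq : r < q := ZMod.val_lt b
  set θ : ℝ := Real.pi * r / q with hθ
  have hexp : ZMod.stdAddChar b + 1 = Complex.exp (θ * Complex.I) * (2 * Real.cos θ) := by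
    rw [ZMod.stdAddChar_apply, ZMod.toCircle_apply, Complex.ofReal_cos, Complex.two_cos, mul_add,
      ← Complex.exp_add, ← Complex.exp_add]
    congr 1
    · congr 1
      rw [hθ]; push_cast; ring
    · rw [neg_mul, add_neg_cancel, Complex.exp_zero]
  have hnorm : ‖(ZMod.stdAddChar a + ZMod.stdAddChar (-a)) / 2‖ = |Real.cos θ| := by
    rw [hfac, hexp, norm_div, norm_mul, norm_mul, norm_stdAddChar, Complex.norm_exp_ofReal_mul_I,
      norm_mul, Complex.norm_real, Real.norm_eq_abs]
    simp
  rw [hnorm]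
  have hrr : (1 : ℝ) ≤ r := by exact_mod_cast hr0
  have hrq' : (r : ℝ) ≤ q - 1 := by
    have : (r : ℝ) + 1 ≤ q := by exact_mod_cast hrq
    linarith
  have key : ∀ t : ℝ, 1 ≤ t → t ≤ q - 1 → Real.cos (Real.pi * t / q) ≤ 1 - 2 / q ^ 2 := by
    intro t ht1 ht2
    have hpi := Real.pi_pos
    have h0 : 0 ≤ Real.pi * t / q := by positivity
    have h1 : Real.pi * t / q ≤ Real.pi := by
      rw [div_le_iff₀ hqp]; nlinarith
    refine (Real.cos_le_one_sub_mul_cos_sq (abs_le.2 ⟨by linarith, h1⟩)).trans ?_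
    have : 2 / Real.pi ^ 2 * (Real.pi * t / q) ^ 2 = 2 / q ^ 2 * t ^ 2 := by
      field_simp
    rw [this]
    have h3 : (0 : ℝ) < 2 / q ^ 2 := by positivity
    have h4 := mul_le_mul_of_nonneg_left (one_le_pow₀ ht1 : 1 ≤ t ^ 2) h3.le
    linarith
  have hcos : |Real.cos θ| ≤ 1 - 2 / q ^ 2 := by
    rw [abs_le]
    constructor
    · have := key (q - r) (by linarith) (by linarith)
      rw [show Real.pi * (q - r) / q = Real.pi - θ by rw [hθ]; field_simp,
        Real.cos_pi_sub] at this
      linarith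
    · exact key r hrr hrq'
  calc |Real.cos θ| ≤ 1 - 2 / q ^ 2 := hcos
    _ ≤ Real.exp (-2 / q ^ 2) := by
      have := Real.add_one_le_exp (-2 / (q : ℝ) ^ 2)
      rw [neg_div] at this ⊢
      linarith

variable {ι : Type*} [Fintype ι] [DecidableEq ι]

theorem expect_stdAddChar_dotProduct (v : ι → ZMod q) :
    𝔼 x : ι → Bool, ZMod.stdAddChar ((fun i => boolSign (ZMod q) (x i)) ⬝ᵥ v)
      = ∏ i, (ZMod.stdAddChar (v i) + ZMod.stdAddChar (-v i)) / 2 := by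
  have h1 : ∀ x : ι → Bool, ZMod.stdAddChar ((fun i => boolSign (ZMod q) (x i)) ⬝ᵥ v)
      = ∏ i, ZMod.stdAddChar (boolSign (ZMod q) (x i) * v i) := by
    intro x
    rw [dotProduct]
    exact map_prod ZMod.stdAddChar.toMonoidHom
      (fun i => Multiplicative.ofAdd (boolSign (ZMod q) (x i) * v i)) univ
  have h2 := (Fintype.prod_sum (fun i b => ZMod.stdAddChar (boolSign (ZMod q) b * v i))).symm
  rw [Fintype.expect_eq_sum_div_card]
  simp_rw [h1]
  rw [h2, Finset.prod_div_distrib]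
  simp [boolSign]

theorem norm_expect_stdAddChar_dotProduct_le (hq : q ≠ 2) (v : ι → ZMod q) (s : ℕ)
    (hs : s ≤ #{i | v i ≠ 0}) :
    ‖𝔼 x : ι → Bool, ZMod.stdAddChar ((fun i => boolSign (ZMod q) (x i)) ⬝ᵥ v)‖
      ≤ Real.exp (-2 * s / q ^ 2) := by
  rw [expect_stdAddChar_dotProduct, norm_prod]
  have hle : ∀ i, ‖(ZMod.stdAddChar (v i) + ZMod.stdAddChar (-v i)) / 2‖
      ≤ if v i ≠ 0 then Real.exp (-2 / q ^ 2) else 1 := by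
    intro i
    split_ifs with h
    · exact norm_stdAddChar_add_neg_le_s15 hq h
    · push Not at h
      simp [h]
  refine (Finset.prod_le_prod (fun _ _ => norm_nonneg _) (fun i _ => hle i)).trans ?_
  rw [Finset.prod_ite, Finset.prod_const, Finset.prod_const_one, mul_one, ← Real.exp_nat_mul]
  apply Real.exp_le_exp.2
  have : (s : ℝ) ≤ (#{i | v i ≠ 0} : ℕ) := by exact_mod_cast hs
  rw [mul_div_assoc', div_le_div_iff_of_pos_right]
  · nlinarith
  · have : (0 : ℝ) < q := by exact_mod_cast (Fact.out : q.Prime).pos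
    positivity

end Fourier

section Averages

variable {ι : Type*} [Fintype ι]

theorem sq_norm_expect_le (g : ι → ℂ) : ‖𝔼 x, g x‖ ^ 2 ≤ 𝔼 x, ‖g x‖ ^ 2 := by
  rcases isEmpty_or_nonempty ι with h | h
  · simp
  have h1 : ‖𝔼 x, g x‖ ≤ 𝔼 x, ‖g x‖ := RCLike.norm_expect_le (K := ℂ)
  have h2 := Finset.expect_mul_sq_le_sq_mul_sq univ (fun x => ‖g x‖) (fun _ => (1 : ℝ))
  simp only [mul_one, one_pow, Fintype.expect_const] at h2
  exact (pow_le_pow_left₀ (norm_nonneg _) h1 2).trans h2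

theorem ofReal_sq_norm_expect (g : ι → ℂ) :
    ((‖𝔼 x, g x‖ ^ 2 : ℝ) : ℂ) = 𝔼 x, 𝔼 y, g x * (starRingEnd ℂ) (g y) := by
  have h : (starRingEnd ℂ) (𝔼 x, g x) = 𝔼 x, (starRingEnd ℂ) (g x) := by
    simp [Fintype.expect_eq_sum_div_card]
  rw [Complex.ofReal_pow, ← Complex.mul_conj', h, Fintype.expect_mul_expect]

variable [DecidableEq ι]

/-- The function that agrees with `y` on `J` and with `x` off `J`. -/
def mix (J : Finset ι) (x y : ι → Bool) : ι → Bool := fun i => if i ∈ J then y i else x i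

theorem expect_mix (J : Finset ι) (f : (ι → Bool) → ℂ) :
    𝔼 x, 𝔼 y, f (mix J x y) = 𝔼 x, f x := by
  have h1 : 𝔼 p : (ι → Bool) × (ι → Bool), f (mix J p.1 p.2) =
      𝔼 p : (ι → Bool) × (ι → Bool), f p.1 := by
    let e : (ι → Bool) × (ι → Bool) → (ι → Bool) × (ι → Bool) :=
      fun p => (mix J p.1 p.2, mix J p.2 p.1)
    have he : Function.Involutive e := by
      rintro ⟨x, y⟩
      simp only [e, Prod.mk.injEq]
      constructor <;> funext i <;> by_cases h : i ∈ J <;> simp [mix, h]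
    exact Fintype.expect_bijective e he.bijective _ _ (fun p => rfl)
  rw [← univ_product_univ, expect_product, expect_product] at h1
  simpa using h1

theorem sq_norm_expect_le_expect_mix (J : Finset ι) (f : (ι → Bool) → ℂ) :
    ‖𝔼 x, f x‖ ^ 2 ≤ 𝔼 y, 𝔼 z, ‖𝔼 x, f (mix J x y) * (starRingEnd ℂ) (f (mix J x z))‖ := by
  rw [← expect_mix J f]
  calc ‖𝔼 x, 𝔼 y, f (mix J x y)‖ ^ 2 ≤ 𝔼 x, ‖𝔼 y, f (mix J x y)‖ ^ 2 := sq_norm_expect_le _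
    _ = ‖((𝔼 x, ‖𝔼 y, f (mix J x y)‖ ^ 2 : ℝ) : ℂ)‖ := by
        rw [Complex.norm_real, Real.norm_of_nonneg]
        exact expect_nonneg fun _ _ => by positivity
    _ = ‖𝔼 x, 𝔼 y, 𝔼 z, f (mix J x y) * (starRingEnd ℂ) (f (mix J x z))‖ := by
        simp_rw [← ofReal_sq_norm_expect]
        rw [Fintype.expect_eq_sum_div_card, Fintype.expect_eq_sum_div_card]
        push_cast
        rfl
    _ = ‖𝔼 y, 𝔼 z, 𝔼 x, f (mix J x y) * (starRingEnd ℂ) (f (mix J x z))‖ := by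
        rw [expect_comm]
        congr 2
        funext y
        rw [expect_comm]
    _ ≤ 𝔼 y, ‖𝔼 z, 𝔼 x, f (mix J x y) * (starRingEnd ℂ) (f (mix J x z))‖ :=
        RCLike.norm_expect_le (K := ℂ)
    _ ≤ 𝔼 y, 𝔼 z, ‖𝔼 x, f (mix J x y) * (starRingEnd ℂ) (f (mix J x z))‖ :=
        expect_le_expect fun y _ => RCLike.norm_expect_le (K := ℂ)

theorem expect_agree (J : Finset ι) (y : ι → Bool)
    [∀ x : ι → Bool, Decidable (∀ i ∈ J, x i = y i)] :
    𝔼 x : ι → Bool, (if ∀ i ∈ J, x i = y i then (1 : ℝ) else 0) = (1 / 2) ^ #J := by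
  have h1 : ∀ x : ι → Bool, (if ∀ i ∈ J, x i = y i then (1 : ℝ) else 0) =
      ∏ i, if i ∈ J then (if x i = y i then (1 : ℝ) else 0) else 1 := by
    intro x
    rw [Finset.prod_ite_mem, univ_inter, Finset.prod_boole]
    congr
  have h2 := (Fintype.prod_sum
    (fun i b => if i ∈ J then (if b = y i then (1 : ℝ) else 0) else 1)).symm
  rw [Fintype.expect_eq_sum_div_card]
  simp_rw [h1]
  rw [h2]
  have h3 : ∀ i, ∑ b : Bool, (if i ∈ J then (if b = y i then (1 : ℝ) else 0) else 1)
      = if i ∈ J then 1 else 2 := by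
    intro i
    split_ifs <;> simp
  simp_rw [h3]
  rw [Finset.prod_ite, prod_const_one, one_mul, prod_const, Fintype.card_fun, Fintype.card_bool]
  have h4 : #J + #{x | x ∉ J} = Fintype.card ι := by
    rw [← Finset.card_univ, ← card_filter_add_card_filter_not (s := univ) (fun x => x ∈ J)]
    simp
  rw [← h4, pow_add]
  push_cast
  field_simp
  rw [← mul_pow]
  norm_num

end Averages

section Anticoncentration

variable {q : ℕ} [Fact q.Prime] {m : ℕ}

theorem expect_perp_le (hq : q ≠ 2) (K : Submodule (ZMod q) (Fin m → ZMod q)) (s : ℕ)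
    (hK : ∀ v ∈ K, v ≠ 0 → s ≤ #{i | v i ≠ 0}) (P : (Fin m → Bool) → Prop) [DecidablePred P]
    (hP : ∀ x, P x → ∀ v ∈ K, v ⬝ᵥ (fun i => boolSign (ZMod q) (x i)) = 0) :
    𝔼 x : Fin m → Bool, (if P x then (1 : ℝ) else 0)
      ≤ 1 / q ^ Module.finrank (ZMod q) K + Real.exp (-2 * s / q ^ 2) := by
  classical
  have hcard : Fintype.card K = q ^ Module.finrank (ZMod q) K := by
    rw [Module.card_eq_pow_finrank (K := ZMod q), ZMod.card]
  let X : (Fin m → Bool) → Fin m → ZMod q := fun x i => boolSign (ZMod q) (x i)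
  have hind : ∀ x, (if P x then (1 : ℝ) else 0)
      ≤ (𝔼 v : K, ZMod.stdAddChar (X x ⬝ᵥ v)).re := by
    intro x
    let φ : K →+ ZMod q :=
      { toFun := fun v => X x ⬝ᵥ v
        map_zero' := by simp
        map_add' := by intro a b; simp [dotProduct_add] }
    let χ : AddChar K ℂ := ZMod.stdAddChar.compAddMonoidHom φ
    have h1 : 𝔼 v : K, ZMod.stdAddChar (X x ⬝ᵥ v) = if χ = 0 then 1 else 0 :=
      AddChar.expect_eq_ite χ
    rw [h1]
    split_ifs with h2 h3 h3
    · simp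
    · refine absurd ?_ h3
      ext v
      have : X x ⬝ᵥ (v : Fin m → ZMod q) = 0 := by
        rw [dotProduct_comm]; exact hP x h2 v v.2
      change ZMod.stdAddChar (X x ⬝ᵥ (v : Fin m → ZMod q)) = _
      simp [this]
    · simp
    · simp
  have hre : ∀ f : (Fin m → Bool) → ℂ, 𝔼 x, (f x).re = (𝔼 x, f x).re := by
    intro f
    rw [Fintype.expect_eq_sum_div_card, Fintype.expect_eq_sum_div_card, ← Complex.re_sum,
      Complex.div_natCast_re]
  calc 𝔼 x : Fin m → Bool, (if P x then (1 : ℝ) else 0)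
      ≤ 𝔼 x : Fin m → Bool, (𝔼 v : K, ZMod.stdAddChar (X x ⬝ᵥ v)).re :=
        expect_le_expect fun x _ => hind x
    _ = (𝔼 x : Fin m → Bool, 𝔼 v : K, ZMod.stdAddChar (X x ⬝ᵥ v)).re := hre _
    _ = (𝔼 v : K, 𝔼 x : Fin m → Bool, ZMod.stdAddChar (X x ⬝ᵥ v)).re := by rw [expect_comm]
    _ ≤ ‖𝔼 v : K, 𝔼 x : Fin m → Bool, ZMod.stdAddChar (X x ⬝ᵥ v)‖ := Complex.re_le_norm _
    _ ≤ 𝔼 v : K, ‖𝔼 x : Fin m → Bool, ZMod.stdAddChar (X x ⬝ᵥ v)‖ :=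
        RCLike.norm_expect_le (K := ℂ)
    _ ≤ 𝔼 v : K, ((if v = 0 then 1 else 0) + Real.exp (-2 * s / q ^ 2)) := by
        refine expect_le_expect fun v _ => ?_
        split_ifs with hv
        · subst hv
          have : (0 : ℝ) ≤ Real.exp (-2 * s / q ^ 2) := (Real.exp_pos _).le
          simpa using this
        · rw [zero_add]
          exact norm_expect_stdAddChar_dotProduct_le hq _ s
            (hK v v.2 (by simpa using hv))
    _ = 1 / q ^ Module.finrank (ZMod q) K + Real.exp (-2 * s / q ^ 2) := by
        rw [expect_add_distrib, Fintype.expect_const, Fintype.expect_eq_sum_div_card, hcard]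
        simp

/-- No nonzero vector that `M` maps into the coordinate subspace of `J` has fewer than
`s + #J` nonzero coordinates. -/
def IsSpread (M : Matrix (Fin m) (Fin m) (ZMod q)) (J : Finset (Fin m)) (s : ℕ) : Prop :=
  ∀ u, u ≠ 0 → (∀ i ∉ J, (M *ᵥ u) i = 0) → s + #J ≤ #{i | u i ≠ 0}

theorem sq_norm_expect_quadratic_le (hq : q ≠ 2) {M : Matrix (Fin m) (Fin m) (ZMod q)}
    (hM : M.IsSymm) (hdet : M.det ≠ 0) {J : Finset (Fin m)} {s : ℕ} (hs : IsSpread M J s)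
    {t : ZMod q} (ht : t ≠ 0) :
    ‖𝔼 x : Fin m → Bool, ZMod.stdAddChar (t * ((fun i => boolSign (ZMod q) (x i)) ⬝ᵥ
      (M⁻¹ *ᵥ (fun i => boolSign (ZMod q) (x i)))))‖ ^ 2
      ≤ (1 / 2) ^ #J + Real.exp (-2 * s / q ^ 2) := by
  have h2 : (2 : ZMod q) ≠ 0 := by
    intro h
    have : ((2 : ℕ) : ZMod q) = 0 := by exact_mod_cast h
    rw [ZMod.natCast_eq_zero_iff] at this
    exact hq ((Nat.prime_dvd_prime_iff_eq Fact.out Nat.prime_two).1 this)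
  set A := M⁻¹ with hA
  have hAs : Aᵀ = A := by rw [hA, transpose_nonsing_inv, hM.eq]
  have hsw : ∀ a b, a ⬝ᵥ (A *ᵥ b) = b ⬝ᵥ (A *ᵥ a) := by
    intro a b
    rw [dotProduct_mulVec, ← mulVec_transpose, hAs, dotProduct_comm]
  let X : (Fin m → Bool) → Fin m → ZMod q := fun x i => boolSign (ZMod q) (x i)
  let f : (Fin m → Bool) → ℂ := fun x => ZMod.stdAddChar (t * (X x ⬝ᵥ (A *ᵥ X x)))
  let b : (Fin m → Bool) → Fin m → ZMod q := fun y i => if i ∈ J then X y i else 0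
  let a : (Fin m → Bool) → Fin m → ZMod q := fun x i => if i ∈ J then 0 else X x i
  let v : (Fin m → Bool) → (Fin m → Bool) → Fin m → ZMod q :=
    fun y z i => if i ∈ J then 0 else 2 * t * (A *ᵥ (b y - b z)) i
  let c : (Fin m → Bool) → (Fin m → Bool) → ZMod q :=
    fun y z => t * (b y ⬝ᵥ (A *ᵥ b y) - b z ⬝ᵥ (A *ᵥ b z))
  have hmix : ∀ x y, X (mix J x y) = a x + b y := by
    intro x y
    funext i
    by_cases hi : i ∈ J <;> simp [X, mix, a, b, hi]
  have hav : ∀ x y z, X x ⬝ᵥ v y z = 2 * t * (a x ⬝ᵥ (A *ᵥ (b y - b z))) := by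
    intro x y z
    simp only [dotProduct, mul_sum]
    refine sum_congr rfl fun i _ => ?_
    by_cases hi : i ∈ J <;> simp [v, a, hi]
    ring
  have hprod : ∀ x y z, f (mix J x y) * (starRingEnd ℂ) (f (mix J x z))
      = ZMod.stdAddChar (c y z) * ZMod.stdAddChar (X x ⬝ᵥ v y z) := by
    intro x y z
    have hconj : ∀ r : ZMod q, (starRingEnd ℂ) (ZMod.stdAddChar r) = ZMod.stdAddChar (-r) :=
      fun r => (AddChar.map_neg_eq_conj _ r).symm
    simp only [f]
    rw [hconj, ← AddChar.map_add_eq_mul, ← AddChar.map_add_eq_mul]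
    congr 1
    rw [hav, hmix, hmix]
    simp only [c, mulVec_add, mulVec_sub, dotProduct_add, dotProduct_sub, add_dotProduct]
    rw [hsw (b y) (a x), hsw (b z) (a x)]
    ring
  have hbound : ∀ y z, ‖𝔼 x, f (mix J x y) * (starRingEnd ℂ) (f (mix J x z))‖
      ≤ (if ∀ i ∈ J, z i = y i then (1 : ℝ) else 0) + Real.exp (-2 * s / q ^ 2) := by
    intro y z
    simp_rw [hprod]
    rw [← mul_expect, norm_mul, norm_stdAddChar, one_mul]
    split_ifs with hyz
    · have h1 : ‖𝔼 x, ZMod.stdAddChar (X x ⬝ᵥ v y z)‖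
          ≤ 𝔼 x : Fin m → Bool, ‖ZMod.stdAddChar (X x ⬝ᵥ v y z)‖ :=
        RCLike.norm_expect_le (K := ℂ)
      simp_rw [norm_stdAddChar] at h1
      rw [Fintype.expect_const] at h1
      have := Real.exp_pos (-2 * s / (q : ℝ) ^ 2)
      linarith
    · rw [zero_add]
      refine norm_expect_stdAddChar_dotProduct_le hq _ s ?_
      set w := b y - b z with hw
      have hMA : M *ᵥ (A *ᵥ w) = w := by
        rw [mulVec_mulVec, hA, Matrix.mul_nonsing_inv _ (isUnit_iff_ne_zero.2 hdet), one_mulVec]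
      have hw0 : w ≠ 0 := by
        push Not at hyz
        obtain ⟨i, hi, hne⟩ := hyz
        intro h0
        have h3 : X y i - X z i = 0 := by simpa [hw, b, hi] using congrFun h0 i
        have h4 : X y i = X z i := sub_eq_zero.1 h3
        have h5 : (1 : ZMod q) ≠ -1 := fun h => h2 (by linear_combination h)
        cases hy : y i <;> cases hz : z i <;> simp_all [X, boolSign]
      have hu0 : A *ᵥ w ≠ 0 := by
        intro h0
        rw [h0, mulVec_zero] at hMA
        exact hw0 hMA.symm
      have hsp := hs (A *ᵥ w) hu0 (by
        intro i hi
        rw [hMA]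
        simp [hw, b, hi])
      have hsub : ({i | (A *ᵥ w) i ≠ 0} : Finset (Fin m)) ⊆ ({i | v y z i ≠ 0} : Finset _) ∪ J := by
        intro i hi
        simp only [mem_filter, mem_univ, true_and, mem_union] at hi ⊢
        by_cases hiJ : i ∈ J
        · exact Or.inr hiJ
        · left
          simp only [v, hiJ, if_false]
          exact mul_ne_zero (mul_ne_zero h2 ht) hi
      have := (card_le_card hsub).trans (card_union_le _ _)
      omega
  calc ‖𝔼 x, f x‖ ^ 2
      ≤ 𝔼 y, 𝔼 z, ‖𝔼 x, f (mix J x y) * (starRingEnd ℂ) (f (mix J x z))‖ :=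
        sq_norm_expect_le_expect_mix J f
    _ ≤ 𝔼 y : Fin m → Bool, 𝔼 z : Fin m → Bool,
          ((if ∀ i ∈ J, z i = y i then (1 : ℝ) else 0) + Real.exp (-2 * s / q ^ 2)) :=
        expect_le_expect fun y _ => expect_le_expect fun z _ => hbound y z
    _ = (1 / 2) ^ #J + Real.exp (-2 * s / q ^ 2) := by
        simp_rw [expect_add_distrib, expect_agree, Fintype.expect_const]

theorem expect_quadratic_eq_le (hq : q ≠ 2) {M : Matrix (Fin m) (Fin m) (ZMod q)}
    (hM : M.IsSymm) (hdet : M.det ≠ 0) {J : Finset (Fin m)} {s : ℕ} (hs : IsSpread M J s)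
    (d : ZMod q) :
    𝔼 x : Fin m → Bool, (if (fun i => boolSign (ZMod q) (x i)) ⬝ᵥ
      (M⁻¹ *ᵥ (fun i => boolSign (ZMod q) (x i))) = d then (1 : ℝ) else 0)
      ≤ 1 / q + √((1 / 2) ^ #J + Real.exp (-2 * s / q ^ 2)) := by
  set δ := √((1 / 2 : ℝ) ^ #J + Real.exp (-2 * s / q ^ 2)) with hδ
  let Q : (Fin m → Bool) → ZMod q := fun x => (fun i => boolSign (ZMod q) (x i)) ⬝ᵥ
      (M⁻¹ *ᵥ (fun i => boolSign (ZMod q) (x i)))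
  change 𝔼 x : Fin m → Bool, (if Q x = d then (1 : ℝ) else 0) ≤ _
  have hind : ∀ x, ((if Q x = d then (1 : ℝ) else 0 : ℝ) : ℂ)
      = 𝔼 t : ZMod q, ZMod.stdAddChar (t * (Q x - d)) := by
    intro x
    have h := AddChar.sum_mulShift (Q x - d) (ZMod.isPrimitive_stdAddChar q)
    rw [Fintype.expect_eq_sum_div_card, h, ZMod.card]
    have hq0 : (q : ℂ) ≠ 0 := by exact_mod_cast (Fact.out : q.Prime).ne_zero
    by_cases hx : Q x = d <;> simp [hx, sub_eq_zero, hq0]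
  have hδ0 : 0 ≤ δ := Real.sqrt_nonneg _
  have hterm : ∀ t : ZMod q, ‖𝔼 x, ZMod.stdAddChar (t * (Q x - d))‖
      ≤ (if t = 0 then 1 else 0) + δ := by
    intro t
    split_ifs with ht
    · subst ht
      simpa using hδ0
    · rw [zero_add]
      have h1 : ∀ x, ZMod.stdAddChar (t * (Q x - d))
          = ZMod.stdAddChar (-(t * d)) * ZMod.stdAddChar (t * Q x) := by
        intro x
        rw [← AddChar.map_add_eq_mul]
        congr 1
        ring
      simp_rw [h1]
      rw [← mul_expect, norm_mul, norm_stdAddChar, one_mul]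
      exact Real.le_sqrt_of_sq_le (sq_norm_expect_quadratic_le hq hM hdet hs ht)
  calc 𝔼 x : Fin m → Bool, (if Q x = d then (1 : ℝ) else 0)
      = ‖((𝔼 x : Fin m → Bool, (if Q x = d then (1 : ℝ) else 0) : ℝ) : ℂ)‖ := by
        rw [Complex.norm_real, Real.norm_of_nonneg]
        exact expect_nonneg fun _ _ => by split_ifs <;> norm_num
    _ = ‖𝔼 x : Fin m → Bool, 𝔼 t : ZMod q, ZMod.stdAddChar (t * (Q x - d))‖ := by
        simp_rw [← hind]
        rw [Fintype.expect_eq_sum_div_card, Fintype.expect_eq_sum_div_card]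
        push_cast
        rfl
    _ = ‖𝔼 t : ZMod q, 𝔼 x : Fin m → Bool, ZMod.stdAddChar (t * (Q x - d))‖ := by
        rw [expect_comm]
    _ ≤ 𝔼 t : ZMod q, ‖𝔼 x : Fin m → Bool, ZMod.stdAddChar (t * (Q x - d))‖ :=
        RCLike.norm_expect_le (K := ℂ)
    _ ≤ 𝔼 t : ZMod q, ((if t = 0 then 1 else 0) + δ) := expect_le_expect fun t _ => hterm t
    _ = 1 / q + δ := by
        rw [expect_add_distrib, Fintype.expect_const, Fintype.expect_eq_sum_div_card, ZMod.card]
        simp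

end Anticoncentration

section CorankStep

/-- The Lyapunov function used to control the corank of growing symmetric matrices. -/
noncomputable def corankWeight : ℕ → ℝ
  | 0 => 0
  | 1 => 1
  | k + 2 => 5 / 2 * 2 ^ k

theorem corankWeight_mono : Monotone corankWeight := by
  refine monotone_nat_of_le_succ fun k => ?_
  match k with
  | 0 => norm_num [corankWeight]
  | 1 => norm_num [corankWeight]
  | k + 2 =>
    simp only [corankWeight, pow_succ]
    have : (0 : ℝ) < 2 ^ k := by positivity
    linarith

theorem corankWeight_nonneg (k : ℕ) : 0 ≤ corankWeight k :=
  corankWeight_mono (Nat.zero_le k)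

theorem corankWeight_le_two_pow (k : ℕ) : corankWeight k ≤ 2 ^ k := by
  match k with
  | 0 => norm_num [corankWeight]
  | 1 => norm_num [corankWeight]
  | k + 2 =>
    simp only [corankWeight, pow_succ]
    have : (0 : ℝ) < 2 ^ k := by positivity
    linarith

theorem corankWeight_succ_le (k : ℕ) :
    corankWeight (k + 2) ≤ 5 / 2 * corankWeight (k + 1) := by
  match k with
  | 0 => norm_num [corankWeight]
  | k + 1 =>
    simp only [corankWeight, pow_succ]
    have : (0 : ℝ) < 2 ^ k := by positivity
    linarith

theorem corankWeight_drift {q : ℝ} (hq : 3 ≤ q) (k : ℕ) :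
    corankWeight k + 1 / q ^ (k + 1) * (corankWeight (k + 2) - corankWeight k)
      ≤ 1 / 2 * corankWeight (k + 1) + 1 / q := by
  have hq0 : 0 < q := by linarith
  have hy : 1 / q ≤ 1 / 3 := one_div_le_one_div_of_le (by norm_num) hq
  have hy0 : 0 < 1 / q := by positivity
  have hpow : ∀ j : ℕ, 1 / q ^ j = (1 / q) ^ j := fun j => by rw [_root_.one_div_pow]
  rw [hpow]
  set y := 1 / q
  match k with
  | 0 =>
    norm_num [corankWeight]
    linarith
  | 1 =>
    norm_num [corankWeight]
    nlinarith
  | k + 2 =>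
    simp only [corankWeight]
    have h1 : (2 * y) ^ k ≤ 1 := pow_le_one₀ (by positivity) (by linarith)
    have h2 : y ^ (k + 2 + 1) * (5 / 2 * 2 ^ (k + 2) - 5 / 2 * 2 ^ k)
        = 15 / 2 * y ^ 3 * (2 * y) ^ k := by
      rw [mul_pow]; ring
    rw [h2]
    have h3 : 15 / 2 * y ^ 3 * (2 * y) ^ k ≤ 15 / 2 * y ^ 3 * 1 := by gcongr
    have h4 : 15 / 2 * y ^ 3 ≤ y := by
      have h5 : y ^ 2 ≤ (1 / 3) ^ 2 := by gcongr
      have h6 := mul_le_mul_of_nonneg_left h5 hy0.le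
      linarith [show y ^ 3 = y * y ^ 2 by ring]
    have h5 : (2 : ℝ) ^ (k + 1) = 2 * 2 ^ k := by ring
    rw [h5]
    linarith

variable {q : ℕ} [Fact q.Prime] {m : ℕ}

theorem expect_corankWeight_bordering_le (hq : q ≠ 2) {M : Matrix (Fin m) (Fin m) (ZMod q)}
    (hM : M.IsSymm) {J : Finset (Fin m)} {s : ℕ} (hs : IsSpread M J s) (d : ZMod q)
    (B : (Fin m → Bool) → Matrix (Fin (m + 1)) (Fin (m + 1)) (ZMod q))
    (hB : ∀ x, IsBordering (B x) M (fun i => boolSign (ZMod q) (x i)) d)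
    {δ : ℝ} (hδ : δ = √((1 / 2) ^ #J + Real.exp (-2 * s / q ^ 2))) :
    𝔼 x, corankWeight (corank (B x))
      ≤ (1 / 2 + 5 / 2 * δ) * corankWeight (corank M) + (1 / q + δ) := by
  classical
  have hδ0 : 0 ≤ δ := hδ ▸ Real.sqrt_nonneg _
  have hq3 : (3 : ℝ) ≤ q := by
    have := (Fact.out : q.Prime).two_le
    exact_mod_cast (by omega : 3 ≤ q)
  by_cases hdet : M.det = 0
  · have hk : corank M ≠ 0 := fun h => corank_eq_zero_iff.1 h hdet
    obtain ⟨k, hk⟩ := Nat.exists_eq_succ_of_ne_zero hk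
    rw [Nat.succ_eq_add_one] at hk
    let P : (Fin m → Bool) → Prop := fun x => ∀ v ∈ LinearMap.ker M.mulVecLin,
      v ⬝ᵥ (fun i => boolSign (ZMod q) (x i)) = 0
    have hexp : Real.exp (-2 * s / q ^ 2) ≤ δ := by
      rw [hδ]
      refine Real.le_sqrt_of_sq_le ?_
      have h1 : Real.exp (-2 * s / q ^ 2) ≤ 1 := by
        rw [Real.exp_le_one_iff, div_nonpos_iff]
        right
        constructor
        · have : (0 : ℝ) ≤ s := by positivity
          linarith
        · positivity
      have h0 := Real.exp_pos (-2 * s / (q : ℝ) ^ 2)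
      have h2 : (0 : ℝ) ≤ (1 / 2) ^ #J := by positivity
      nlinarith
    have hperp := expect_perp_le hq (LinearMap.ker M.mulVecLin) s (fun v hv hv0 => by
      have h := hs v hv0 (fun i _ => congrFun (LinearMap.mem_ker.1 hv) i)
      omega) P (fun x hx => hx)
    rw [show Module.finrank (ZMod q) (LinearMap.ker M.mulVecLin) = k + 1 from hk] at hperp
    have hpt : ∀ x, corankWeight (corank (B x)) ≤ corankWeight k +
        (if P x then 1 else 0) * (corankWeight (k + 2) - corankWeight k) := by
      intro x
      split_ifs with hx
      · have := corankWeight_mono (hB x).corank_le_succ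
        rw [hk] at this
        linarith
      · simp only [P, not_forall] at hx
        obtain ⟨v, hv, hvx⟩ := hx
        have := (hB x).corank_lt hM hv hvx
        rw [hk] at this
        simpa using corankWeight_mono (Nat.lt_succ_iff.1 this)
    have hmono : corankWeight k ≤ corankWeight (k + 2) := corankWeight_mono (by omega)
    calc 𝔼 x, corankWeight (corank (B x))
        ≤ 𝔼 x : Fin m → Bool, (corankWeight k +
          (if P x then 1 else 0) * (corankWeight (k + 2) - corankWeight k)) :=
          expect_le_expect fun x _ => hpt x
      _ = corankWeight k + (𝔼 x : Fin m → Bool, if P x then (1 : ℝ) else 0) *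
          (corankWeight (k + 2) - corankWeight k) := by
          rw [expect_add_distrib, Fintype.expect_const, ← expect_mul]
      _ ≤ corankWeight k + (1 / q ^ (k + 1) + δ) * (corankWeight (k + 2) - corankWeight k) := by
          gcongr
          linarith
      _ ≤ (1 / 2 + 5 / 2 * δ) * corankWeight (corank M) + (1 / q + δ) := by
          rw [hk]
          have h1 := corankWeight_drift hq3 k
          have h2 := mul_le_mul_of_nonneg_left (corankWeight_succ_le k) hδ0
          have h3 := mul_nonneg hδ0 (corankWeight_nonneg k)
          linarith
  · rw [corank_eq_zero_iff.2 hdet]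
    have h1 : ∀ x, corankWeight (corank (B x)) ≤ if (fun i => boolSign (ZMod q) (x i)) ⬝ᵥ
        (M⁻¹ *ᵥ (fun i => boolSign (ZMod q) (x i))) = d then (1 : ℝ) else 0 := by
      intro x
      split_ifs with hx
      · have := corankWeight_mono (hB x).corank_le_succ
        rwa [corank_eq_zero_iff.2 hdet] at this
      · rw [(hB x).corank_eq_zero hdet hx]
        exact le_refl _
    refine (expect_le_expect fun x _ => h1 x).trans ?_
    refine (expect_quadratic_eq_le hq hM hdet hs d).trans ?_
    rw [← hδ]
    simp [corankWeight]

end CorankStep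

section Resampling

variable {α β : Type*} [Fintype α] [Fintype β] [DecidableEq α] [DecidableEq β]

theorem expect_extend {e : α → β} (he : Function.Injective e) (f : (β → Bool) → ℝ) :
    𝔼 z, 𝔼 x : α → Bool, f (Function.extend e x z) = 𝔼 z, f z := by
  have h1 : 𝔼 p : (β → Bool) × (α → Bool), f (Function.extend e p.2 p.1) =
      𝔼 p : (β → Bool) × (α → Bool), f p.1 := by
    let g : (β → Bool) × (α → Bool) → (β → Bool) × (α → Bool) :=
      fun p => (Function.extend e p.2 p.1, p.1 ∘ e)
    have hg : Function.Involutive g := by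
      rintro ⟨z, x⟩
      simp only [g, Prod.mk.injEq]
      refine ⟨?_, Function.extend_comp he x z⟩
      funext b
      by_cases hb : ∃ a, e a = b
      · obtain ⟨a, rfl⟩ := hb
        simp [he.extend_apply]
      · rw [Function.extend_apply' _ _ _ hb, Function.extend_apply' _ _ _ hb]
    exact Fintype.expect_bijective g hg.bijective _ _ (fun p => rfl)
  rw [← univ_product_univ, expect_product, expect_product] at h1
  simpa using h1

theorem expect_ite_le_of_determined (R : Finset β) (P : (β → Bool) → Prop) [DecidablePred P]
    (h : ∀ σ τ, P σ → P τ → (∀ b ∉ R, σ b = τ b) → σ = τ) :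
    𝔼 σ : β → Bool, (if P σ then (1 : ℝ) else 0) ≤ 1 / 2 ^ #R := by
  have hinj : Fintype.card {σ : β → Bool // P σ} ≤ Fintype.card ({b // b ∉ R} → Bool) := by
    refine Fintype.card_le_of_injective (fun σ b => σ.1 b.1) ?_
    intro σ τ hστ
    exact Subtype.ext (h _ _ σ.2 τ.2 fun b hb => congrFun hστ ⟨b, hb⟩)
  rw [Fintype.card_subtype, Fintype.card_fun, Fintype.card_bool, Fintype.card_subtype_compl,
    Fintype.card_coe] at hinj
  have hR : #R ≤ Fintype.card β := card_le_univ R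
  rw [Fintype.expect_eq_sum_div_card, sum_boole, Fintype.card_fun, Fintype.card_bool,
    div_le_div_iff₀ (by positivity) (by positivity), one_mul]
  calc ((#{σ | P σ} : ℕ) : ℝ) * 2 ^ #R
      ≤ 2 ^ (Fintype.card β - #R) * 2 ^ #R := by
        gcongr
        exact_mod_cast hinj
    _ = ((2 ^ Fintype.card β : ℕ) : ℝ) := by
        rw [← pow_add, Nat.sub_add_cancel hR]
        norm_num

theorem card_sparse_le {F : Type*} [Zero F] [Fintype F] [DecidableEq F] (r : ℕ) :
    #{u : α → F | u ≠ 0 ∧ #{i | u i ≠ 0} ≤ r} ≤ (Fintype.card α * Fintype.card F) ^ r := by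
  classical
  let φ : (Fin r → α) × (Fin r → F) → α → F :=
    fun p i => if h : ∃ k, p.1 k = i then p.2 h.choose else 0
  have hsub : ({u : α → F | u ≠ 0 ∧ #{i | u i ≠ 0} ≤ r} : Finset _) ⊆ univ.image φ := by
    intro u hu
    simp only [mem_filter, mem_univ, true_and] at hu
    obtain ⟨hu0, hur⟩ := hu
    obtain ⟨i₀, hi₀⟩ := Function.ne_iff.1 hu0
    have : Nonempty {i // u i ≠ 0} := ⟨⟨i₀, hi₀⟩⟩
    obtain ⟨emb⟩ : Nonempty ({i // u i ≠ 0} ↪ Fin r) := by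
      refine Function.Embedding.nonempty_of_card_le ?_
      rwa [Fintype.card_subtype, Fintype.card_fin]
    let g : Fin r → α := fun k => (Function.invFun emb k).1
    refine mem_image.2 ⟨(g, fun k => u (g k)), mem_univ _, ?_⟩
    funext i
    simp only [φ]
    split_ifs with h
    · rw [h.choose_spec]
    · by_contra hne
      refine h ⟨emb ⟨i, fun h0 => hne h0.symm⟩, ?_⟩
      simp only [g]
      rw [Function.leftInverse_invFun emb.injective]
  refine (card_le_card hsub).trans (card_image_le.trans ?_)
  simp [Fintype.card_prod, mul_pow]

end Resampling

section Minors

variable {n : ℕ}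

/-- The Boolean in position `(a, b)` of a table, with value `false` outside the table. -/
def tableEntry (σ : Fin n × Fin n → Bool) (a b : ℕ) : Bool :=
  if h : a < n ∧ b < n then σ (⟨a, h.1⟩, ⟨b, h.2⟩) else false

/-- The leading `m × m` minor modulo `q` of the symmetric sign matrix given by a table. -/
def leadingMinor (q m : ℕ) (σ : Fin n × Fin n → Bool) : Matrix (Fin m) (Fin m) (ZMod q) :=
  fun i j => boolSign (ZMod q) (tableEntry σ (min i j) (max i j))

theorem leadingMinor_isSymm (q m : ℕ) (σ : Fin n × Fin n → Bool) :
    (leadingMinor q m σ).IsSymm := by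
  ext i j
  simp [leadingMinor, min_comm, max_comm]

/-- The positions of the off-diagonal entries of the column `m`. -/
def columnPos {m : ℕ} (hm : m < n) (i : Fin m) : Fin n × Fin n :=
  (⟨i, i.2.trans hm⟩, ⟨m, hm⟩)

theorem columnPos_injective {m : ℕ} (hm : m < n) : Function.Injective (columnPos hm) := by
  intro i j h
  simpa [columnPos, Fin.ext_iff] using h

theorem tableEntry_extend_of_ne {m : ℕ} (hm : m < n) (x : Fin m → Bool)
    (σ : Fin n × Fin n → Bool) {a b : ℕ} (h : b ≠ m ∨ a = m) :
    tableEntry (Function.extend (columnPos hm) x σ) a b = tableEntry σ a b := by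
  unfold tableEntry
  split_ifs with hab
  · rw [Function.extend_apply']
    rintro ⟨i, hi⟩
    simp only [columnPos, Prod.mk.injEq, Fin.mk.injEq] at hi
    have := i.2
    omega
  · rfl

theorem tableEntry_extend {m : ℕ} (hm : m < n) (x : Fin m → Bool)
    (σ : Fin n × Fin n → Bool) (i : Fin m) :
    tableEntry (Function.extend (columnPos hm) x σ) i m = x i := by
  unfold tableEntry
  rw [dif_pos ⟨i.2.trans hm, hm⟩]
  exact (columnPos_injective hm).extend_apply x σ i

theorem leadingMinor_extend (q : ℕ) {m j : ℕ} (hm : m < n) (hj : j ≤ m) (x : Fin m → Bool)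
    (σ : Fin n × Fin n → Bool) :
    leadingMinor q j (Function.extend (columnPos hm) x σ) = leadingMinor q j σ := by
  ext a b
  unfold leadingMinor
  rw [tableEntry_extend_of_ne]
  left
  have := a.2
  have := b.2
  omega

theorem leadingMinor_isBordering (q : ℕ) [Fact q.Prime] {m : ℕ} (hm : m < n) (x : Fin m → Bool)
    (σ : Fin n × Fin n → Bool) :
    IsBordering (leadingMinor q (m + 1) (Function.extend (columnPos hm) x σ))
      (leadingMinor q m σ) (fun i => boolSign (ZMod q) (x i))
      (boolSign (ZMod q) (tableEntry σ m m)) where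
  block i j := by
    rw [← leadingMinor_extend q hm le_rfl x σ]
    rfl
  col i := by
    have hi := i.2
    simp only [leadingMinor, Fin.val_castSucc, Fin.val_last, min_eq_left hi.le, max_eq_right hi.le,
      tableEntry_extend]
  row i := by
    have hi := i.2
    simp only [leadingMinor, Fin.val_castSucc, Fin.val_last, min_eq_right hi.le, max_eq_left hi.le,
      tableEntry_extend]
  corner := by
    simp only [leadingMinor, Fin.val_last, min_self, max_self]
    rw [tableEntry_extend_of_ne _ _ _ (Or.inr rfl)]

variable {q : ℕ} [Fact q.Prime]

theorem boolSign_injective (hq : q ≠ 2) : Function.Injective (boolSign (ZMod q)) := by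
  have h5 : (1 : ZMod q) ≠ -1 := by
    intro h
    have : ((2 : ℕ) : ZMod q) = 0 := by push_cast; linear_combination h
    rw [ZMod.natCast_eq_zero_iff] at this
    exact hq ((Nat.prime_dvd_prime_iff_eq Fact.out Nat.prime_two).1 this)
  intro a b hab
  cases a <;> cases b <;> simp_all [boolSign]

theorem expect_mulVec_eq_zero_le (hq : q ≠ 2) {m : ℕ} (hm : m ≤ n) (J : Finset (Fin m))
    {u : Fin m → ZMod q} (hu : u ≠ 0)
    [DecidablePred fun σ : Fin n × Fin n → Bool => ∀ i ∉ J, (leadingMinor q m σ *ᵥ u) i = 0] :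
    𝔼 σ : Fin n × Fin n → Bool,
      (if ∀ i ∉ J, (leadingMinor q m σ *ᵥ u) i = 0 then (1 : ℝ) else 0)
      ≤ 2 ^ (#J + #{i | u i ≠ 0}) / 2 ^ m := by
  obtain ⟨j₀, hj₀⟩ := Function.ne_iff.1 hu
  have hj₀ : u j₀ ≠ 0 := hj₀
  let pos : Fin m → Fin m → Fin n × Fin n := fun i j =>
    (⟨min i j, by omega⟩, ⟨max i j, by omega⟩)
  have hentry : ∀ (σ : Fin n × Fin n → Bool) i j,
      leadingMinor q m σ i j = boolSign (ZMod q) (σ (pos i j)) := by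
    intro σ i j
    unfold leadingMinor tableEntry
    rw [dif_pos ⟨by omega, by omega⟩]
  let S : Finset (Fin m) := {i | u i ≠ 0}
  let R : Finset (Fin n × Fin n) := (univ \ (J ∪ S)).image (fun i => pos i j₀)
  have hR : m ≤ #R + (#J + #S) := by
    have h1 : #R = #(univ \ (J ∪ S)) := by
      refine card_image_of_injOn ?_
      intro a ha b hb hab
      simp only [coe_sdiff, coe_univ, coe_union, Set.mem_sdiff, Set.mem_univ, true_and,
        Set.mem_union, not_or, mem_coe] at ha hb
      have hS : j₀ ∈ S := by simpa [S] using hj₀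
      have hne : a ≠ j₀ := fun h => ha.2 (h ▸ hS)
      have hne' : b ≠ j₀ := fun h => hb.2 (h ▸ hS)
      simp only [pos, Prod.mk.injEq, Fin.mk.injEq] at hab
      ext
      rw [Ne, Fin.ext_iff] at hne hne'
      omega
    have h2 := card_sdiff_add_card (univ : Finset (Fin m)) (J ∪ S)
    have h3 := card_union_le J S
    have h4 : m ≤ #(univ ∪ (J ∪ S)) := by
      simpa using card_le_card (subset_union_left (s₁ := (univ : Finset (Fin m))) (s₂ := J ∪ S))
    omega
  refine (expect_ite_le_of_determined R _ ?_).trans ?_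
  · intro σ τ hσ hτ hagree
    have hrow : ∀ i, i ∉ J → i ∉ S → σ (pos i j₀) = τ (pos i j₀) := by
      intro i hiJ hiS
      have h0 : ∑ j, (leadingMinor q m σ i j - leadingMinor q m τ i j) * u j = 0 := by
        have h1 := hσ i hiJ
        have h2 := hτ i hiJ
        simp only [mulVec, dotProduct] at h1 h2
        simp only [sub_mul, sum_sub_distrib, h1, h2, sub_zero]
      rw [Finset.sum_eq_single j₀] at h0
      · have h1 := (mul_eq_zero.1 h0).resolve_right hj₀
        rw [hentry, hentry] at h1
        exact boolSign_injective hq (sub_eq_zero.1 h1)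
      · intro j _ hj
        by_cases hjS : u j = 0
        · rw [hjS, mul_zero]
        · have hiS' : u i = 0 := by simpa [S] using hiS
          rw [hentry, hentry, hagree, sub_self, zero_mul]
          simp only [R, mem_image, mem_sdiff, mem_univ, true_and, mem_union, not_or]
          rintro ⟨k, ⟨hkJ, hkS⟩, hk⟩
          have hkS' : u k = 0 := by simpa [S] using hkS
          have hij : i ≠ j₀ := by rintro rfl; exact hj₀ hiS'
          have hkj : k ≠ j := by rintro rfl; exact hjS hkS'
          simp only [pos, Prod.mk.injEq, Fin.mk.injEq] at hk
          rw [Ne, Fin.ext_iff] at hj hij hkj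
          omega
      · simp
    funext b
    by_cases hb : b ∈ R
    · simp only [R, mem_image, mem_sdiff, mem_univ, true_and, mem_union, not_or] at hb
      obtain ⟨i, ⟨hiJ, hiS⟩, rfl⟩ := hb
      exact hrow i hiJ hiS
    · exact hagree b hb
  · rw [div_le_div_iff₀ (by positivity) (by positivity), one_mul, ← pow_add]
    have hS : #S = #{i | u i ≠ 0} := rfl
    exact pow_le_pow_right₀ (by norm_num) (by omega)

theorem expect_not_isSpread_le (hq : q ≠ 2) {m : ℕ} (hm : m ≤ n) (J : Finset (Fin m)) (s : ℕ)
    [DecidablePred fun σ : Fin n × Fin n → Bool => ¬ IsSpread (leadingMinor q m σ) J s] :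
    𝔼 σ : Fin n × Fin n → Bool,
      (if ¬ IsSpread (leadingMinor q m σ) J s then (1 : ℝ) else 0)
      ≤ (m * q) ^ (s + #J) * 2 ^ (#J + (s + #J)) / 2 ^ m := by
  classical
  let U : Finset (Fin m → ZMod q) := {u | u ≠ 0 ∧ #{i | u i ≠ 0} ≤ s + #J}
  have hpt : ∀ σ : Fin n × Fin n → Bool,
      (if ¬ IsSpread (leadingMinor q m σ) J s then (1 : ℝ) else 0)
      ≤ ∑ u ∈ U, if ∀ i ∉ J, (leadingMinor q m σ *ᵥ u) i = 0 then (1 : ℝ) else 0 := by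
    intro σ
    by_cases h : IsSpread (leadingMinor q m σ) J s
    · rw [if_neg (not_not.2 h)]
      exact sum_nonneg fun v _ => by split_ifs <;> norm_num
    · rw [if_pos h]
      simp only [IsSpread, not_forall, not_le] at h
      obtain ⟨u, hu0, hu, hlt⟩ := h
      have hmem : u ∈ U := by simpa [U] using ⟨hu0, hlt.le⟩
      refine le_trans ?_ (single_le_sum (fun v _ => ?_) hmem)
      · rw [if_pos (fun i hi => hu i hi)]
      · split_ifs <;> norm_num
  have hcard : (#U : ℝ) ≤ (m * q) ^ (s + #J) := by
    have := card_sparse_le (α := Fin m) (F := ZMod q) (s + #J)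
    rw [Fintype.card_fin, ZMod.card] at this
    exact_mod_cast this
  calc 𝔼 σ : Fin n × Fin n → Bool,
        (if ¬ IsSpread (leadingMinor q m σ) J s then (1 : ℝ) else 0)
      ≤ 𝔼 σ : Fin n × Fin n → Bool,
          ∑ u ∈ U, if ∀ i ∉ J, (leadingMinor q m σ *ᵥ u) i = 0 then (1 : ℝ) else 0 :=
        expect_le_expect fun σ _ => hpt σ
    _ = ∑ u ∈ U, 𝔼 σ : Fin n × Fin n → Bool,
          if ∀ i ∉ J, (leadingMinor q m σ *ᵥ u) i = 0 then (1 : ℝ) else 0 := expect_sum_comm ..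
    _ ≤ ∑ u ∈ U, (2 : ℝ) ^ (#J + (s + #J)) / 2 ^ m := by
        refine sum_le_sum fun u hu => ?_
        have hu' : u ≠ 0 ∧ #{i | u i ≠ 0} ≤ s + #J := by simpa [U] using hu
        refine (expect_mulVec_eq_zero_le hq hm J hu'.1).trans ?_
        gcongr
        · norm_num
        · exact hu'.2
    _ ≤ (m * q) ^ (s + #J) * 2 ^ (#J + (s + #J)) / 2 ^ m := by
        rw [sum_const, nsmul_eq_mul, mul_div_assoc]
        gcongr

/-- The set of the first `s` indices. -/
def initialIndices (m s : ℕ) : Finset (Fin m) := {i | (i : ℕ) < s}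

theorem card_initialIndices {m s : ℕ} (h : s ≤ m) : #(initialIndices m s) = s := by
  simp [initialIndices, Fin.card_filter_val_lt, h]

/-- All leading minors of sizes in `[m₀, m)` are spread. -/
def MinorsSpread (q s m₀ m : ℕ) [Fact q.Prime] (σ : Fin n × Fin n → Bool) : Prop :=
  ∀ j, m₀ ≤ j → j < m → IsSpread (leadingMinor q j σ) (initialIndices j s) s

open Classical in
theorem expect_corankWeight_succ_le (hq : q ≠ 2) {s m₀ m : ℕ} (hs : s ≤ m₀) (hm₀ : m₀ ≤ m)
    (hm : m < n) {δ : ℝ} (hδ : δ = √((1 / 2) ^ s + Real.exp (-2 * s / q ^ 2))) :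
    𝔼 σ : Fin n × Fin n → Bool,
      (if MinorsSpread q s m₀ (m + 1) σ then corankWeight (corank (leadingMinor q (m + 1) σ)) else 0)
      ≤ (1 / 2 + 5 / 2 * δ) * (𝔼 σ : Fin n × Fin n → Bool,
      (if MinorsSpread q s m₀ m σ then corankWeight (corank (leadingMinor q m σ)) else 0))
        + (1 / q + δ) := by
  have hδ0 : 0 ≤ δ := hδ ▸ Real.sqrt_nonneg _
  rw [← expect_extend (columnPos_injective hm), mul_expect,
    ← Fintype.expect_const (ι := Fin n × Fin n → Bool) (1 / (q : ℝ) + δ), ← expect_add_distrib]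
  refine expect_le_expect fun σ _ => ?_
  have hiff : ∀ x : Fin m → Bool, MinorsSpread q s m₀ (m + 1)
      (Function.extend (columnPos hm) x σ) ↔ MinorsSpread q s m₀ (m + 1) σ := by
    intro x
    unfold MinorsSpread
    refine forall_congr' fun j => forall_congr' fun _ => forall_congr' fun hj => ?_
    rw [leadingMinor_extend q hm (Nat.lt_succ_iff.1 hj)]
  simp_rw [hiff]
  have hc : 0 ≤ 1 / (q : ℝ) + δ := by positivity
  by_cases h : MinorsSpread q s m₀ (m + 1) σ
  · have h' : MinorsSpread q s m₀ m σ := fun j hj hj' => h j hj (by omega)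
    simp only [h, h', if_true]
    refine expect_corankWeight_bordering_le hq (leadingMinor_isSymm q m σ)
      (h m hm₀ (Nat.lt_succ_self m)) _ _ (fun x => leadingMinor_isBordering q hm x σ) ?_
    rw [card_initialIndices (hs.trans hm₀), hδ]
  · simp only [h, if_false, Fintype.expect_const]
    refine add_nonneg (mul_nonneg (by positivity) ?_) hc
    split_ifs
    · exact corankWeight_nonneg _
    · exact le_rfl

open Classical in
theorem expect_corankWeight_le (hq : q ≠ 2) {s m₀ : ℕ} (hs : s ≤ m₀) {δ : ℝ}
    (hδ : δ = √((1 / 2) ^ s + Real.exp (-2 * s / q ^ 2))) (hδ1 : δ ≤ 1 / 20) (k : ℕ)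
    (hk : m₀ + k ≤ n) :
    𝔼 σ : Fin n × Fin n → Bool, (if MinorsSpread q s m₀ (m₀ + k) σ then
        corankWeight (corank (leadingMinor q (m₀ + k) σ)) else 0)
      ≤ (5 / 8) ^ k * 2 ^ m₀ + (1 / q + δ) / (1 / 2 - 5 / 2 * δ) := by
  have hδ0 : 0 ≤ δ := hδ ▸ Real.sqrt_nonneg _
  have hden : 0 < 1 / 2 - 5 / 2 * δ := by linarith
  have hc : 0 ≤ 1 / (q : ℝ) + δ := by positivity
  induction k with
  | zero =>
    refine expect_le univ_nonempty fun σ _ => ?_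
    have h1 : (0 : ℝ) ≤ (1 / q + δ) / (1 / 2 - 5 / 2 * δ) := by positivity
    have h2 : corankWeight (corank (leadingMinor q (m₀ + 0) σ)) ≤ 2 ^ m₀ :=
      (corankWeight_mono corank_le).trans (corankWeight_le_two_pow _)
    have h3 : (0 : ℝ) ≤ 2 ^ m₀ := by positivity
    split_ifs <;> linarith
  | succ k ih =>
    refine (expect_corankWeight_succ_le hq hs (Nat.le_add_right m₀ k) (by omega) hδ).trans ?_
    have h1 := mul_le_mul_of_nonneg_left (ih (by omega))
      (by positivity : 0 ≤ 1 / 2 + 5 / 2 * δ)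
    refine (add_le_add_left h1 _).trans ?_
    have h2 : (1 / 2 + 5 / 2 * δ) * ((1 / q + δ) / (1 / 2 - 5 / 2 * δ)) + (1 / q + δ)
        = (1 / q + δ) / (1 / 2 - 5 / 2 * δ) := by
      have h := div_mul_cancel₀ (1 / (q : ℝ) + δ) hden.ne'
      generalize (1 / (q : ℝ) + δ) / (1 / 2 - 5 / 2 * δ) = y at h ⊢
      linear_combination -h
    have h3 : (1 / 2 + 5 / 2 * δ) * ((5 / 8) ^ k * 2 ^ m₀) ≤ (5 / 8) ^ (k + 1) * 2 ^ m₀ := by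
      rw [pow_succ]
      have : (0 : ℝ) ≤ (5 / 8) ^ k * 2 ^ m₀ := by positivity
      nlinarith
    rw [mul_add, add_assoc, h2]
    linarith

theorem signMatrix_map_eq_leadingMinor (q : ℕ) (σ : Fin n → Fin n → Bool) :
    (signMatrix n σ).map (Int.cast : ℤ → ZMod q) = leadingMinor q n (fun p => σ p.1 p.2) := by
  ext i j
  have h1 : (⟨min i j, by omega⟩ : Fin n) = min i j := by
    ext; simp [Fin.coe_min]
  have h2 : (⟨max i j, by omega⟩ : Fin n) = max i j := by
    ext; simp [Fin.coe_max]
  simp only [Matrix.map_apply, signMatrix, leadingMinor, tableEntry, boolSign]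
  rw [dif_pos ⟨by omega, by omega⟩, h1, h2]
  split_ifs <;> simp

open Classical in
theorem probSym_singular_eq (q : ℕ) [Fact q.Prime] :
    probSym n (fun M => (M.map (Int.cast : ℤ → ZMod q)).det = 0) =
      𝔼 σ : Fin n × Fin n → Bool, if corank (leadingMinor q n σ) ≠ 0 then (1 : ℝ) else 0 := by
  have h : 𝔼 σ : Fin n × Fin n → Bool, (if corank (leadingMinor q n σ) ≠ 0 then (1 : ℝ) else 0) =
      𝔼 σ : Fin n → Fin n → Bool, if ((signMatrix n σ).map (Int.cast : ℤ → ZMod q)).det = 0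
        then (1 : ℝ) else 0 := by
    refine Fintype.expect_equiv (Equiv.curry (Fin n) (Fin n) Bool) _ _ fun σ => ?_
    rw [signMatrix_map_eq_leadingMinor]
    simp only [ne_eq, corank_eq_zero_iff, not_not]
    rfl
  rw [h, Fintype.expect_eq_sum_div_card, sum_boole, probSym, Nat.card_eq_fintype_card,
    Fintype.card_subtype]

theorem probSym_singular_le (hq : q ≠ 2) {s m₀ : ℕ} (hs : s ≤ m₀) (hm₀ : m₀ ≤ n) {δ : ℝ}
    (hδ : δ = √((1 / 2) ^ s + Real.exp (-2 * s / q ^ 2))) (hδ1 : δ ≤ 1 / 20) :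
    probSym n (fun M => (M.map (Int.cast : ℤ → ZMod q)).det = 0) ≤
      n * ((n * q) ^ (2 * s) * 8 ^ s / 2 ^ m₀) + (5 / 8) ^ (n - m₀) * 2 ^ m₀ +
        (1 / q + δ) / (1 / 2 - 5 / 2 * δ) := by
  classical
  rw [probSym_singular_eq]
  have hchain := expect_corankWeight_le (n := n) hq hs hδ hδ1 (n - m₀) (by omega)
  rw [Nat.add_sub_cancel' hm₀] at hchain
  have hspread : ∀ j ∈ Ico m₀ n, 𝔼 σ : Fin n × Fin n → Bool,
      (if ¬ IsSpread (leadingMinor q j σ) (initialIndices j s) s then (1 : ℝ) else 0)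
      ≤ (n * q) ^ (2 * s) * 8 ^ s / 2 ^ m₀ := by
    intro j hj
    rw [mem_Ico] at hj
    refine (expect_not_isSpread_le hq hj.2.le (initialIndices j s) s).trans ?_
    rw [card_initialIndices (hs.trans hj.1), ← two_mul,
      show (8 : ℝ) ^ s = 2 ^ (s + 2 * s) by
        rw [show s + 2 * s = 3 * s by ring, pow_mul]; norm_num]
    gcongr
    · exact hj.2.le
    · norm_num
    · exact hj.1
  have hpt : ∀ σ : Fin n × Fin n → Bool, (if corank (leadingMinor q n σ) ≠ 0 then (1 : ℝ) else 0)
      ≤ ∑ j ∈ Ico m₀ n,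
          (if ¬ IsSpread (leadingMinor q j σ) (initialIndices j s) s then (1 : ℝ) else 0) +
        (if MinorsSpread q s m₀ n σ then corankWeight (corank (leadingMinor q n σ)) else 0) := by
    intro σ
    have hsum : ∀ j, (0 : ℝ) ≤
        if ¬ IsSpread (leadingMinor q j σ) (initialIndices j s) s then (1 : ℝ) else 0 := by
      intro j; split_ifs <;> norm_num
    have hsum0 := sum_nonneg fun j (_ : j ∈ Ico m₀ n) => hsum j
    have hw := corankWeight_nonneg (corank (leadingMinor q n σ))
    by_cases hsp : MinorsSpread q s m₀ n σ
    · rw [if_pos hsp]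
      split_ifs with h
      · have : (1 : ℝ) ≤ corankWeight (corank (leadingMinor q n σ)) :=
          corankWeight_mono (Nat.one_le_iff_ne_zero.2 h)
        linarith
      · linarith
    · rw [if_neg hsp, add_zero]
      simp only [MinorsSpread, not_forall] at hsp
      obtain ⟨j, hj1, hj2, hj⟩ := hsp
      have h1 := single_le_sum (fun j _ => hsum j) (mem_Ico.2 ⟨hj1, hj2⟩)
      rw [if_pos hj] at h1
      refine le_trans ?_ h1
      split_ifs <;> norm_num
  calc 𝔼 σ : Fin n × Fin n → Bool, (if corank (leadingMinor q n σ) ≠ 0 then (1 : ℝ) else 0)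
      ≤ 𝔼 σ : Fin n × Fin n → Bool, (∑ j ∈ Ico m₀ n,
          (if ¬ IsSpread (leadingMinor q j σ) (initialIndices j s) s then (1 : ℝ) else 0) +
        (if MinorsSpread q s m₀ n σ then corankWeight (corank (leadingMinor q n σ)) else 0)) :=
        expect_le_expect fun σ _ => hpt σ
    _ = ∑ j ∈ Ico m₀ n, 𝔼 σ : Fin n × Fin n → Bool,
          (if ¬ IsSpread (leadingMinor q j σ) (initialIndices j s) s then (1 : ℝ) else 0) +
        𝔼 σ : Fin n × Fin n → Bool,
          (if MinorsSpread q s m₀ n σ then corankWeight (corank (leadingMinor q n σ)) else 0) := by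
        rw [expect_add_distrib, expect_sum_comm]
    _ ≤ ∑ j ∈ Ico m₀ n, ((n * q : ℝ) ^ (2 * s) * 8 ^ s / 2 ^ m₀) +
        ((5 / 8) ^ (n - m₀) * 2 ^ m₀ + (1 / q + δ) / (1 / 2 - 5 / 2 * δ)) :=
        add_le_add (sum_le_sum hspread) hchain
    _ ≤ _ := by
        rw [sum_const, nsmul_eq_mul, Nat.card_Ico, ← add_assoc]
        gcongr
        omega

end Minors

section Asymptotics

open Filter Topology

theorem half_pow_le_exp {s q : ℕ} (hq : 3 ≤ q) :
    (1 / 2 : ℝ) ^ s ≤ Real.exp (-2 * s / q ^ 2) := by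
  have h3 : (3 : ℝ) ≤ q := by exact_mod_cast hq
  have hlog := Real.log_two_gt_d9
  rw [one_div, inv_pow, ← Real.exp_log (show (0 : ℝ) < 2 by norm_num), ← Real.exp_nat_mul,
    ← Real.exp_neg, Real.exp_le_exp, Real.exp_log (by norm_num), neg_mul, neg_div, neg_le_neg_iff,
    div_le_iff₀ (by positivity)]
  have : (2 : ℝ) ≤ Real.log 2 * q ^ 2 := by nlinarith
  nlinarith [(Nat.cast_nonneg s : (0 : ℝ) ≤ s)]

/-- The conditions on a large dimension `n` under which the bound on the singularity
probability simplifies. -/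
structure IsLargeDimension (η ε : ℝ) (n : ℕ) : Prop where
  log_sq : 200 ≤ Real.log n ^ 2
  two_div : 2 / (n : ℝ) ≤ η ^ 2
  two_hundred_log : 200 * Real.log n ≤ n
  sq_mul_exp : 2 * (n : ℝ) ^ 2 * Real.exp (-(n / 20)) ≤ ε / 4

theorem eventually_isLargeDimension {η ε : ℝ} (hη : 0 < η) (hε : 0 < ε) :
    ∀ᶠ n : ℕ in atTop, IsLargeDimension η ε n := by
  have hlog : Tendsto (fun n : ℕ => Real.log n) atTop atTop :=
    Real.tendsto_log_atTop.comp tendsto_natCast_atTop_atTop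
  have h1 : ∀ᶠ n : ℕ in atTop, 200 ≤ Real.log n ^ 2 :=
    ((tendsto_pow_atTop two_ne_zero).comp hlog).eventually_ge_atTop 200
  have h2 : ∀ᶠ n : ℕ in atTop, 2 / (n : ℝ) ≤ η ^ 2 :=
    (tendsto_const_div_atTop_nhds_zero_nat (2 : ℝ)).eventually_le_const (by positivity)
  have h3 : ∀ᶠ n : ℕ in atTop, 200 * Real.log n ≤ n := by
    have := (Real.isLittleO_log_id_atTop.comp_tendsto tendsto_natCast_atTop_atTop).bound
      (show (0 : ℝ) < 1 / 200 by norm_num)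
    filter_upwards [this, hlog.eventually_ge_atTop 0] with n hn hn0
    simp only [Function.comp_apply, id, Real.norm_eq_abs, abs_of_nonneg hn0, Nat.abs_cast] at hn
    linarith
  have h4 : ∀ᶠ n : ℕ in atTop, 2 * (n : ℝ) ^ 2 * Real.exp (-(n / 20)) ≤ ε / 4 := by
    have ht := (Real.tendsto_pow_mul_exp_neg_atTop_nhds_zero 2).comp
      (tendsto_natCast_atTop_atTop.atTop_div_const (show (0 : ℝ) < 20 by norm_num))
    filter_upwards [ht.eventually_le_const (show 0 < ε / 3200 by positivity)] with n hn
    simp only [Function.comp_apply] at hn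
    nlinarith
  filter_upwards [h1, h2, h3, h4] with n a b c d using ⟨a, b, c, d⟩

variable {η ε : ℝ} {n q : ℕ}

theorem sqrt_half_pow_add_exp_le (hn : IsLargeDimension η ε n) (hη : 0 < η) (hn3 : 3 ≤ n)
    (hq : 3 ≤ q) (hqn : (q : ℝ) ^ 2 ≤ n / Real.log n ^ 4)
    {s : ℕ} (hs : (n : ℝ) / (200 * Real.log n) ≤ s) :
    √((1 / 2) ^ s + Real.exp (-2 * s / q ^ 2)) ≤ η / q := by
  have hq0 : (0 : ℝ) < q := by positivity
  have hn0 : (0 : ℝ) < n := by positivity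
  have hL : 0 < Real.log n := Real.log_pos (by exact_mod_cast (by omega : 1 < n))
  have hqn' : (q : ℝ) ^ 2 ≤ n := by
    refine hqn.trans (div_le_self hn0.le ?_)
    nlinarith [hn.log_sq]
  have hexp : 2 * Real.log n ≤ 2 * s / q ^ 2 := by
    rw [le_div_iff₀ (by positivity)]
    rw [div_le_iff₀ (by positivity)] at hs
    rw [le_div_iff₀ (by positivity)] at hqn
    have h1 : (q : ℝ) ^ 2 * Real.log n ^ 2 * Real.log n ^ 2 ≤ s * (200 * Real.log n) := by
      nlinarith
    have h2 : (q : ℝ) ^ 2 * Real.log n * Real.log n * 200 ≤ s * 200 * Real.log n := by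
      have : (q : ℝ) ^ 2 * Real.log n ^ 2 * 200 ≤
          (q : ℝ) ^ 2 * Real.log n ^ 2 * Real.log n ^ 2 := by
        gcongr
        exact hn.log_sq
      nlinarith
    have h3 : (q : ℝ) ^ 2 * Real.log n ≤ s := by
      refine le_of_mul_le_mul_right ?_ (show 0 < Real.log n * 200 by positivity)
      linarith
    linarith
  have hbound : Real.exp (-2 * s / q ^ 2) ≤ 1 / (n : ℝ) ^ 2 := by
    have : (n : ℝ) ^ 2 = Real.exp (2 * Real.log n) := by
      rw [mul_comm, Real.exp_mul, Real.exp_log hn0]; norm_num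
    rw [this, one_div, ← Real.exp_neg, Real.exp_le_exp, neg_mul, neg_div]
    linarith
  rw [Real.sqrt_le_left (by positivity), div_pow η, le_div_iff₀ (by positivity)]
  calc ((1 / 2 : ℝ) ^ s + Real.exp (-2 * s / q ^ 2)) * (q : ℝ) ^ 2
      ≤ (1 / (n : ℝ) ^ 2 + 1 / (n : ℝ) ^ 2) * n := by
        gcongr
        exact (half_pow_le_exp hq).trans hbound
    _ = 2 / (n : ℝ) := by field_simp; norm_num
    _ ≤ η ^ 2 := hn.two_div

theorem not_spread_term_le (hn : IsLargeDimension η ε n) (hn3 : 3 ≤ n) (hqn : q ≤ n)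
    {s : ℕ} (hs : (s : ℝ) * (100 * Real.log n) ≤ n) :
    q * (n * (((n : ℝ) * q) ^ (2 * s) * 8 ^ s / 2 ^ (n / 4))) ≤ ε / 4 := by
  have hn0 : (0 : ℝ) < n := by positivity
  have hL : 1 ≤ Real.log n := by
    have : 0 < Real.log n := Real.log_pos (by exact_mod_cast (by omega : 1 < n))
    nlinarith [hn.log_sq]
  have hqn' : (q : ℝ) ≤ n := by exact_mod_cast hqn
  have hs0 : (0 : ℝ) ≤ s := s.cast_nonneg
  have h1 : ((n : ℝ) * q) ^ (2 * s) ≤ Real.exp (n / 25) := by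
    calc ((n : ℝ) * q) ^ (2 * s) ≤ (n * n) ^ (2 * s) := by gcongr
      _ = Real.exp ((4 * s : ℕ) * Real.log n) := by
        rw [Real.exp_nat_mul, Real.exp_log hn0]; ring
      _ ≤ Real.exp (n / 25) := by
        rw [Real.exp_le_exp]; push_cast; linarith
  have hlog := Real.log_two_gt_d9
  have hlog' := Real.log_two_lt_d9
  have h2 : (8 : ℝ) ^ s ≤ Real.exp (3 * n / 100) := by
    calc (8 : ℝ) ^ s = Real.exp ((3 * s : ℕ) * Real.log 2) := by
          rw [Real.exp_nat_mul, Real.exp_log (by norm_num), pow_mul]; norm_num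
      _ ≤ Real.exp (3 * n / 100) := by
        rw [Real.exp_le_exp]; push_cast; nlinarith
  have h3 : Real.exp (3 * n / 20) / 2 ≤ 2 ^ (n / 4) := by
    have hdiv : (n : ℝ) ≤ 4 * ((n / 4 : ℕ) : ℝ) + 3 := by
      exact_mod_cast (by omega : n ≤ 4 * (n / 4) + 3)
    have : Real.exp (3 * n / 20) ≤ Real.exp ((n / 4 + 1 : ℕ) * Real.log 2) := by
      rw [Real.exp_le_exp]; push_cast; nlinarith
    rw [Real.exp_nat_mul, Real.exp_log (by norm_num), pow_succ] at this
    linarith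
  calc (q : ℝ) * (n * (((n : ℝ) * q) ^ (2 * s) * 8 ^ s / 2 ^ (n / 4)))
      ≤ n * (n * (Real.exp (n / 25) * Real.exp (3 * n / 100) / (Real.exp (3 * n / 20) / 2))) := by
        gcongr
    _ = 2 * (n : ℝ) ^ 2 * Real.exp (-(2 * n / 25)) := by
        rw [show -(2 * (n : ℝ) / 25) = n / 25 + 3 * n / 100 - 3 * n / 20 by ring, Real.exp_sub,
          Real.exp_add]
        field_simp
    _ ≤ 2 * (n : ℝ) ^ 2 * Real.exp (-(n / 20)) := by
        gcongr _ * Real.exp ?_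
        linarith
    _ ≤ ε / 4 := hn.sq_mul_exp

theorem initial_term_le (hn : IsLargeDimension η ε n) (hn3 : 3 ≤ n) (hqn : q ≤ n) :
    q * ((5 / 8 : ℝ) ^ (n - n / 4) * 2 ^ (n / 4)) ≤ ε / 4 := by
  have hqn' : (q : ℝ) ≤ n := by exact_mod_cast hqn
  have hn1 : (1 : ℝ) ≤ n := by exact_mod_cast (by omega : 1 ≤ n)
  have hlog := Real.log_two_gt_d9
  have hdiv : (n : ℝ) ≤ 4 * ((n / 4 : ℕ) : ℝ) + 3 := by
    exact_mod_cast (by omega : n ≤ 4 * (n / 4) + 3)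
  have h1 : (5 / 8 : ℝ) ^ (n - n / 4) * 2 ^ (n / 4) ≤ (1 / 2) ^ (n / 4) := by
    calc (5 / 8 : ℝ) ^ (n - n / 4) * 2 ^ (n / 4) ≤ (5 / 8) ^ (3 * (n / 4)) * 2 ^ (n / 4) := by
          gcongr ?_ * _
          exact pow_le_pow_of_le_one (by norm_num) (by norm_num) (by omega)
      _ = ((5 / 8) ^ 3 * 2) ^ (n / 4) := by rw [pow_mul, mul_pow]
      _ ≤ (1 / 2) ^ (n / 4) := by gcongr; norm_num
  have h2 : (1 / 2 : ℝ) ^ (n / 4) ≤ 2 * Real.exp (-(n / 20)) := by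
    have : Real.exp (n / 20) ≤ Real.exp ((n / 4 + 1 : ℕ) * Real.log 2) := by
      rw [Real.exp_le_exp]; push_cast; nlinarith
    rw [Real.exp_nat_mul, Real.exp_log (by norm_num), pow_succ] at this
    rw [one_div, inv_pow, Real.exp_neg, ← div_eq_mul_inv, inv_le_iff_one_le_mul₀ (by positivity),
      div_mul_eq_mul_div, one_le_div (by positivity)]
    linarith
  calc (q : ℝ) * ((5 / 8 : ℝ) ^ (n - n / 4) * 2 ^ (n / 4))
      ≤ n ^ 2 * (2 * Real.exp (-(n / 20))) := by
        refine mul_le_mul ?_ (h1.trans h2) (by positivity) (by positivity)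
        nlinarith
    _ = 2 * (n : ℝ) ^ 2 * Real.exp (-(n / 20)) := by ring
    _ ≤ ε / 4 := hn.sq_mul_exp

theorem probSym_singular_le_of_isLargeDimension [Fact q.Prime] (hε : 0 < ε)
    (hη : η = min (1 / 20) (ε / 100)) (hn : IsLargeDimension η ε n) (hn3 : 3 ≤ n) (hq : q ≠ 2)
    (hqn : (q : ℝ) ≤ √n / Real.log n ^ 2) :
    probSym n (fun M => (M.map (Int.cast : ℤ → ZMod q)).det = 0) ≤ (2 + ε) / q := by
  have hq3 : 3 ≤ q := by
    have := (Fact.out : q.Prime).two_le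
    omega
  have hq0 : (0 : ℝ) < q := by positivity
  have hq3' : (3 : ℝ) ≤ q := by exact_mod_cast hq3
  have hn1 : (3 : ℝ) ≤ n := by exact_mod_cast hn3
  have hη0 : 0 < η := by rw [hη]; positivity
  have hη1 : η ≤ 1 / 20 := hη ▸ min_le_left _ _
  have hη2 : η ≤ ε / 100 := hη ▸ min_le_right _ _
  have hL : 0 < Real.log n := Real.log_pos (by linarith)
  have hL1 : 1 ≤ Real.log n := by nlinarith [hn.log_sq]
  have hqsq : (q : ℝ) ^ 2 ≤ n / Real.log n ^ 4 := by
    calc (q : ℝ) ^ 2 ≤ (√n / Real.log n ^ 2) ^ 2 := by gcongr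
      _ = n / Real.log n ^ 4 := by rw [div_pow, Real.sq_sqrt (by positivity)]; ring
  have hqle : q ≤ n := by
    have h1 : (q : ℝ) ^ 2 ≤ n :=
      hqsq.trans (div_le_self (by positivity) (one_le_pow₀ hL1))
    have : (q : ℝ) ≤ n := by nlinarith
    exact_mod_cast this
  let s := ⌊(n : ℝ) / (100 * Real.log n)⌋₊
  have hs1 : (s : ℝ) * (100 * Real.log n) ≤ n := by
    rw [← le_div_iff₀ (by positivity)]
    exact Nat.floor_le (by positivity)
  have hs2 : (n : ℝ) / (200 * Real.log n) ≤ s := by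
    have h1 : (n : ℝ) / (100 * Real.log n) < s + 1 := Nat.lt_floor_add_one _
    have h2 : (n : ℝ) / (100 * Real.log n) = 2 * (n / (200 * Real.log n)) := by
      field_simp; norm_num
    have h3 : 1 ≤ (n : ℝ) / (200 * Real.log n) := by
      rw [one_le_div (by positivity)]
      exact hn.two_hundred_log
    linarith
  have hs3 : s ≤ n / 4 := by
    rw [Nat.le_div_iff_mul_le (by norm_num)]
    have : (s : ℝ) * 4 ≤ n := by nlinarith [(Nat.cast_nonneg s : (0 : ℝ) ≤ s)]
    exact_mod_cast this
  obtain ⟨δ, hδ⟩ : ∃ δ, δ = √((1 / 2) ^ s + Real.exp (-2 * s / q ^ 2)) := ⟨_, rfl⟩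
  have hδ0 : 0 ≤ δ := hδ ▸ Real.sqrt_nonneg _
  have hδq : δ ≤ η / q := hδ ▸ sqrt_half_pow_add_exp_le hn hη0 hn3 hq3 hqsq hs2
  have hδq' : δ * q ≤ η := by rwa [le_div_iff₀ hq0] at hδq
  have hδη : δ ≤ η := by nlinarith
  refine (probSym_singular_le hq hs3 (Nat.div_le_self n 4) hδ (hδη.trans hη1)).trans ?_
  rw [le_div_iff₀ hq0]
  have hmain : (1 / q + δ) / (1 / 2 - 5 / 2 * δ) * q ≤ 2 + ε / 2 := by
    rw [div_mul_eq_mul_div, div_le_iff₀ (by linarith), add_mul, one_div_mul_cancel hq0.ne']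
    nlinarith
  have h1 := not_spread_term_le hn hn3 hqle hs1
  have h2 := initial_term_le hn hn3 hqle
  linarith

end Asymptotics

end SignMatrices

/-- There is a constant `C > 0` such that for every `ε > 0`, for all sufficiently
large `n` and every odd prime `q ≤ n^(1/2)/(log n)^C`, the probability that `M_n`
reduced mod `q` is singular over the field `ℤ/qℤ` is at most `(2 + ε)/q`. -/
theorem singular_mod_q_bound :
    ∃ C > (0 : ℝ), ∀ ε > (0 : ℝ), ∃ N : ℕ, ∀ n : ℕ, N ≤ n → ∀ q : ℕ,
      q.Prime → q ≠ 2 → (q : ℝ) ≤ Real.sqrt n / (Real.log n) ^ C →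
      probSym n (fun M => (M.map (Int.cast : ℤ → ZMod q)).det = 0)
        ≤ (2 + ε) / q := by
  refine ⟨2, two_pos, fun ε hε => ?_⟩
  have hη : 0 < min (1 / 20) (ε / 100) := by positivity
  obtain ⟨N, hN⟩ := Filter.eventually_atTop.1 (eventually_isLargeDimension hη hε)
  refine ⟨max N 3, fun n hn q hq hq2 hqn => ?_⟩
  have : Fact q.Prime := ⟨hq⟩
  rw [Real.rpow_two] at hqn
  exact probSym_singular_le_of_isLargeDimension hε rfl (hN n (le_of_max_le_left hn))
    (le_of_max_le_right hn) hq2 hqn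
end
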